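/- For every θ ∈ (0,1), M > 0, and 0 < v₀ ≤ v₁, there exists a constant c > 0, depending only on θ, M, v₀, v₁, with the following property. Let G be a finite additive group with |G| ≥ 2, let ĉ : G → ℝ satisfy ĉ(g) ≥ 0 and ĉ(−g) = ĉ(g) for all g, let κ₀ ≥ θ, define E(φ) = (1/2)·Σ_{x,y∈G} ĉ(y − x)·(φ y − φ x)² + κ₀·Σ_{x∈G} (φ x)², and let μ be the probability measure on G → ℝ with density proportional to exp(−E(φ)/2) with respect to Lebesgue measure. Assume v₀ ≤ ∫ (φ x)² dμ(φ) ≤ v₁ for all x ∈ G. Then for every translation-invariant increasing set A ⊆ (G → Bool) and every h ∈ (−M, M): −(deriv of the function h ↦ (μ(A^h)).toReal at h) ≥ c · μ(A^h)·(1 − μ(A^h)) · log |G|. (Corollary 4.4, equation (4.11), in the periodic / translation-invariant setting.) -/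

import Mathlib

open MeasureTheory Real

/-- The level-set event `A^h = {φ | (1{h ≤ φ x})_x ∈ A}`. -/
def levSet {G : Type} (A : Set (G → Bool)) (h : ℝ) : Set (G → ℝ) :=
  {φ | (fun x => decide (h ≤ φ x)) ∈ A}

namespace LevelSetThreshold

section FourFunctions

open scoped ENNReal

/-- Two numbers dominated by `c` whose product is at most `c * d` have sum at most `c + d`. -/
lemma add_le_add_of_mul_le_mul {a b c d : ℝ≥0∞} (hac : a ≤ c) (hbc : b ≤ c)
    (h : a * b ≤ c * d) : a + b ≤ c + d := by
  rcases eq_or_ne c ∞ with rfl | hc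
  · simp
  rcases eq_or_ne d ∞ with rfl | hd
  · simp
  lift c to NNReal using hc
  lift d to NNReal using hd
  lift a to NNReal using ne_top_of_le_ne_top ENNReal.coe_ne_top hac
  lift b to NNReal using ne_top_of_le_ne_top ENNReal.coe_ne_top hbc
  norm_cast at *
  rcases eq_or_ne c 0 with rfl | hc0
  · have ha : a = 0 := le_antisymm hac zero_le
    have hb : b = 0 := le_antisymm hbc zero_le
    simp [ha, hb]
  have hc' : 0 < c := pos_iff_ne_zero.mpr hc0
  rw [← NNReal.coe_le_coe] at *
  push_cast at *
  have hc'' : (0 : ℝ) < c := by exact_mod_cast hc'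
  by_contra! hlt
  nlinarith [mul_nonneg (sub_nonneg.2 hac) (sub_nonneg.2 hbc)]

/-- The four functions inequality on a linear order. -/
lemma lintegral_four_functions_linear (ν : Measure ℝ) [SFinite ν] {f₁ f₂ f₃ f₄ : ℝ → ℝ≥0∞}
    (h₁ : Measurable f₁) (h₂ : Measurable f₂) (h₃ : Measurable f₃) (h₄ : Measurable f₄)
    (h : ∀ s t, f₁ s * f₂ t ≤ f₃ (s ⊓ t) * f₄ (s ⊔ t)) :
    (∫⁻ s, f₁ s ∂ν) * ∫⁻ t, f₂ t ∂ν ≤ (∫⁻ s, f₃ s ∂ν) * ∫⁻ t, f₄ t ∂ν := by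
  have sym {u v : ℝ → ℝ≥0∞} (hu : Measurable u) (hv : Measurable v) :
      2 * ((∫⁻ s, u s ∂ν) * ∫⁻ t, v t ∂ν) = ∫⁻ p, (u p.1 * v p.2 + v p.1 * u p.2) ∂(ν.prod ν) := by
    rw [lintegral_add_left (by fun_prop), lintegral_prod_mul hu.aemeasurable hv.aemeasurable,
      lintegral_prod_mul hv.aemeasurable hu.aemeasurable, two_mul]
    congr 1
    rw [mul_comm]
  have key (s t : ℝ) (hst : s ≤ t) : f₁ s * f₂ t + f₂ s * f₁ t ≤ f₃ s * f₄ t + f₄ s * f₃ t := by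
    rw [mul_comm (f₄ s)]
    apply add_le_add_of_mul_le_mul
    · simpa [hst] using h s t
    · simpa [hst, mul_comm] using h t s
    · have e₁ := h s s
      have e₂ := h t t
      simp only [inf_idem, sup_idem] at e₁ e₂
      calc f₁ s * f₂ t * (f₂ s * f₁ t) = (f₁ s * f₂ s) * (f₁ t * f₂ t) := by ring
        _ ≤ (f₃ s * f₄ s) * (f₃ t * f₄ t) := mul_le_mul' e₁ e₂
        _ = f₃ s * f₄ t * (f₃ t * f₄ s) := by ring
  have h2 : 2 * ((∫⁻ s, f₁ s ∂ν) * ∫⁻ t, f₂ t ∂ν) ≤ 2 * ((∫⁻ s, f₃ s ∂ν) * ∫⁻ t, f₄ t ∂ν) := by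
    rw [sym h₁ h₂, sym h₃ h₄]
    refine lintegral_mono fun p => ?_
    rcases le_total p.1 p.2 with hp | hp
    · exact key _ _ hp
    · have := key _ _ hp
      rw [add_comm, mul_comm (f₂ p.1), mul_comm (f₁ p.1), add_comm (f₃ p.1 * _),
        mul_comm (f₃ p.1), mul_comm (f₄ p.1)]
      exact this
  exact (ENNReal.mul_le_mul_iff_right (by simp) (by simp)).1 h2

/-- The four functions inequality for Lebesgue measure on `ι → ℝ`. -/
theorem lintegral_four_functions {ι : Type*} [Fintype ι] {f₁ f₂ f₃ f₄ : (ι → ℝ) → ℝ≥0∞}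
    (h₁ : Measurable f₁) (h₂ : Measurable f₂) (h₃ : Measurable f₃) (h₄ : Measurable f₄)
    (h : ∀ x y, f₁ x * f₂ y ≤ f₃ (x ⊓ y) * f₄ (x ⊔ y)) :
    (∫⁻ x, f₁ x) * ∫⁻ x, f₂ x ≤ (∫⁻ x, f₃ x) * ∫⁻ x, f₄ x := by
  classical
  suffices H : ∀ s : Finset ι, ∀ x y,
      (∫⋯∫⁻_s, f₁ ∂fun _ => volume) x * (∫⋯∫⁻_s, f₂ ∂fun _ => volume) y ≤
        (∫⋯∫⁻_s, f₃ ∂fun _ => volume) (x ⊓ y) * (∫⋯∫⁻_s, f₄ ∂fun _ => volume) (x ⊔ y) by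
    simpa [volume_pi] using H Finset.univ 0 0
  intro s
  induction s using Finset.induction_on with
  | empty => simpa using h
  | insert i s hi ih =>
    intro x y
    simp only [lmarginal_insert _ h₁ hi, lmarginal_insert _ h₂ hi, lmarginal_insert _ h₃ hi,
      lmarginal_insert _ h₄ hi]
    refine lintegral_four_functions_linear volume
      ((h₁.lmarginal _).comp (measurable_update x)) ((h₂.lmarginal _).comp (measurable_update y))
      ((h₃.lmarginal _).comp (measurable_update _)) ((h₄.lmarginal _).comp (measurable_update _))
      fun t u => ?_
    have hinf : Function.update (x ⊓ y) i (t ⊓ u) =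
        Function.update x i t ⊓ Function.update y i u := by
      ext j
      rcases eq_or_ne j i with rfl | hj <;> simp [*]
    have hsup : Function.update (x ⊔ y) i (t ⊔ u) =
        Function.update x i t ⊔ Function.update y i u := by
      ext j
      rcases eq_or_ne j i with rfl | hj <;> simp [*]
    rw [hinf, hsup]
    exact ih _ _

end FourFunctions

section ProductSpace

variable {n : ℕ} {S : Type}

/-- The configuration equal to `s` on the coordinates below `k` and to `t` on the others. -/
def splice (k : ℕ) (s t : Fin n → S) : Fin n → S := fun i => if (i : ℕ) < k then s i else t i

lemma splice_update {k : ℕ} {j : Fin n} (hj : (j : ℕ) < k) (s t : Fin n → S) (a : S) :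
    splice k (Function.update s j a) t = Function.update (splice k s t) j a := by
  ext i
  rcases eq_or_ne i j with rfl | h
  · simp [splice, hj]
  · simp [splice, h]

variable [Fintype S]

/-- Expectation of `F` under the product of the weights `w i`. -/
def expect (w : Fin n → S → ℝ) (F : (Fin n → S) → ℝ) : ℝ :=
  ∑ s, (∏ i, w i (s i)) * F s

/-- Average of `F` over the coordinate `j`. -/
def avg (w : Fin n → S → ℝ) (j : Fin n) (F : (Fin n → S) → ℝ) : (Fin n → S) → ℝ :=
  fun s => ∑ a, w j a * F (Function.update s j a)

/-- Conditional expectation of `F` given the coordinates below `k`. -/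
def prefixExpect (w : Fin n → S → ℝ) (k : ℕ) (F : (Fin n → S) → ℝ) : (Fin n → S) → ℝ :=
  fun s => expect w fun t => F (splice k s t)

/-- Difference of `F` between the values `top j` and `bot j` of the coordinate `j`. -/
def coordDiff (top bot : Fin n → S) (j : Fin n) (F : (Fin n → S) → ℝ) : (Fin n → S) → ℝ :=
  fun s => F (Function.update s j (top j)) - F (Function.update s j (bot j))

variable {w : Fin n → S → ℝ}

lemma expect_add (F H : (Fin n → S) → ℝ) :
    expect w (fun s => F s + H s) = expect w F + expect w H := by
  simp [expect, mul_add, Finset.sum_add_distrib]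

lemma expect_sub (F H : (Fin n → S) → ℝ) :
    expect w (fun s => F s - H s) = expect w F - expect w H := by
  simp [expect, mul_sub, Finset.sum_sub_distrib]

lemma expect_const_mul (c : ℝ) (F : (Fin n → S) → ℝ) :
    expect w (fun s => c * F s) = c * expect w F := by
  simp only [expect, Finset.mul_sum]
  exact Finset.sum_congr rfl fun s _ => by ring

lemma expect_sum {ι : Type*} (I : Finset ι) (F : ι → (Fin n → S) → ℝ) :
    expect w (fun s => ∑ i ∈ I, F i s) = ∑ i ∈ I, expect w (F i) := by
  simp only [expect, Finset.mul_sum]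
  exact Finset.sum_comm

lemma expect_mono (hw : ∀ i a, 0 ≤ w i a) {F H : (Fin n → S) → ℝ} (h : ∀ s, F s ≤ H s) :
    expect w F ≤ expect w H :=
  Finset.sum_le_sum fun s _ =>
    mul_le_mul_of_nonneg_left (h s) (Finset.prod_nonneg fun i _ => hw i _)

lemma expect_const (hw1 : ∀ i, ∑ a, w i a = 1) (c : ℝ) :
    expect w (fun _ : Fin n → S => c) = c := by
  classical
  rw [expect, ← Finset.sum_mul, ← Fintype.prod_sum]
  simp [hw1]

lemma expect_nonneg (hw : ∀ i a, 0 ≤ w i a) {F : (Fin n → S) → ℝ} (h : ∀ s, 0 ≤ F s) :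
    0 ≤ expect w F :=
  Finset.sum_nonneg fun s _ => mul_nonneg (Finset.prod_nonneg fun i _ => hw i _) (h s)

lemma expect_avg (hw1 : ∀ i, ∑ a, w i a = 1) (j : Fin n) (F : (Fin n → S) → ℝ) :
    expect w (avg w j F) = expect w F := by
  have hprod (s : Fin n → S) (a : S) : (∏ i, w i (s i)) * w j a =
      (∏ i, w i (Function.update s j a i)) * w j (s j) := by
    rw [← Finset.mul_prod_erase Finset.univ (fun i => w i (s i)) (Finset.mem_univ j),
      ← Finset.mul_prod_erase Finset.univ (fun i => w i (Function.update s j a i))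
        (Finset.mem_univ j)]
    have : ∏ i ∈ Finset.univ.erase j, w i (Function.update s j a i) =
        ∏ i ∈ Finset.univ.erase j, w i (s i) :=
      Finset.prod_congr rfl fun i hi => by simp [Finset.ne_of_mem_erase hi]
    rw [this, Function.update_self]
    ring
  calc expect w (avg w j F)
      = ∑ p : (Fin n → S) × S, (∏ i, w i (Function.update p.1 j p.2 i)) * w j (p.1 j) *
          F (Function.update p.1 j p.2) := by
        rw [Fintype.sum_prod_type]
        refine Finset.sum_congr rfl fun s _ => ?_
        rw [avg, Finset.mul_sum]
        refine Finset.sum_congr rfl fun a _ => ?_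
        rw [← mul_assoc, hprod]
    _ = ∑ p : (Fin n → S) × S, (∏ i, w i (p.1 i)) * w j p.2 * F p.1 := by
        refine Finset.sum_bij' (fun p _ => (Function.update p.1 j p.2, p.1 j))
          (fun p _ => (Function.update p.1 j p.2, p.1 j)) ?_ ?_ ?_ ?_ ?_ <;> simp
    _ = expect w F := by
        rw [Fintype.sum_prod_type]
        refine Finset.sum_congr rfl fun s _ => ?_
        simp only [← Finset.mul_sum, ← Finset.sum_mul, hw1, mul_one]

lemma avg_update (j : Fin n) (F : (Fin n → S) → ℝ) (s : Fin n → S) (a : S) :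
    avg w j F (Function.update s j a) = avg w j F s := by
  simp [avg]

lemma expect_mul_avg (hw1 : ∀ i, ∑ a, w i a = 1) (j : Fin n) (F H : (Fin n → S) → ℝ)
    (hH : ∀ s a, H (Function.update s j a) = H s) :
    expect w (fun s => H s * avg w j F s) = expect w (fun s => H s * F s) := by
  rw [← expect_avg hw1 j fun s => H s * F s]
  congr 1
  ext s
  simp only [avg, hH, Finset.mul_sum]
  exact Finset.sum_congr rfl fun a _ => by ring

lemma expect_sq_sub_avg (hw1 : ∀ i, ∑ a, w i a = 1) (j : Fin n) (F : (Fin n → S) → ℝ) :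
    expect w (fun s => (F s - avg w j F s) ^ 2) =
      expect w (fun s => F s ^ 2) - expect w (fun s => avg w j F s ^ 2) := by
  have h := expect_mul_avg hw1 j F (avg w j F) (avg_update j F)
  have e : (fun s => (F s - avg w j F s) ^ 2) =
      fun s => (F s ^ 2 - 2 * (avg w j F s * F s)) + avg w j F s ^ 2 := by
    ext s; ring
  rw [e, expect_add, expect_sub, expect_const_mul, ← h]
  simp only [← pow_two]
  ring

lemma prefixExpect_last (hw1 : ∀ i, ∑ a, w i a = 1) (F : (Fin n → S) → ℝ) :
    prefixExpect w n F = F := by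
  ext s
  have : ∀ t : Fin n → S, splice n s t = s := fun t => by ext i; simp [splice]
  simp only [prefixExpect, this]
  exact expect_const hw1 _

lemma prefixExpect_zero (F : (Fin n → S) → ℝ) (s : Fin n → S) :
    prefixExpect w 0 F s = expect w F := by
  have : ∀ t : Fin n → S, splice 0 s t = t := fun t => by ext i; simp [splice]
  simp only [prefixExpect, this]

lemma avg_prefixExpect_succ (hw1 : ∀ i, ∑ a, w i a = 1) (k : Fin n) (F : (Fin n → S) → ℝ) :
    avg w k (prefixExpect w (k + 1) F) = prefixExpect w k F := by
  ext s
  have hs (t : Fin n → S) (a : S) : splice (k + 1) (Function.update s k a) t =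
      splice k s (Function.update t k a) := by
    ext i
    rcases lt_trichotomy i k with h | rfl | h
    · have h' : (i : ℕ) < k := h
      simp [splice, h', h.ne, Nat.lt_succ_of_lt h']
    · simp [splice]
    · have h' : (k : ℕ) < i := h
      simp [splice, h.ne', not_lt.2 h'.le, not_le.2 h']
  rw [prefixExpect, ← expect_avg hw1 k, avg]
  simp only [prefixExpect, hs, ← expect_const_mul]
  rw [← expect_sum]
  rfl

lemma prefixExpect_congr (k : ℕ) (F : (Fin n → S) → ℝ) {s s' : Fin n → S}
    (h : ∀ i : Fin n, (i : ℕ) < k → s i = s' i) : prefixExpect w k F s = prefixExpect w k F s' := by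
  have : ∀ t, splice k s t = splice k s' t := fun t => by
    ext i
    by_cases hi : (i : ℕ) < k <;> simp [splice, hi, h]
  simp only [prefixExpect, this]

lemma prefixExpect_update (k : ℕ) (F : (Fin n → S) → ℝ) {j : Fin n} (hj : k ≤ j)
    (s : Fin n → S) (a : S) :
    prefixExpect w k F (Function.update s j a) = prefixExpect w k F s := by
  refine prefixExpect_congr k F fun i hi => ?_
  have : i ≠ j := by rintro rfl; omega
  simp [this]

lemma expect_prefixExpect (hw1 : ∀ i, ∑ a, w i a = 1) (k : ℕ) (hk : k ≤ n)
    (F : (Fin n → S) → ℝ) : expect w (prefixExpect w k F) = expect w F := by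
  induction hk using Nat.decreasingInduction with
  | self => rw [prefixExpect_last hw1]
  | of_succ k hk ih =>
    rw [← ih, ← avg_prefixExpect_succ hw1 ⟨k, hk⟩, expect_avg hw1]

lemma coordDiff_prefixExpect (top bot : Fin n → S) {k : ℕ} {j : Fin n} (hj : (j : ℕ) < k)
    (F : (Fin n → S) → ℝ) :
    coordDiff top bot j (prefixExpect w k F) = prefixExpect w k (coordDiff top bot j F) := by
  ext s
  simp only [coordDiff, prefixExpect, splice_update hj, expect_sub]

lemma coordDiff_prefixExpect_of_le (top bot : Fin n → S) {k : ℕ} {j : Fin n} (hj : k ≤ j)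
    (F : (Fin n → S) → ℝ) (s : Fin n → S) :
    coordDiff top bot j (prefixExpect w k F) s = 0 := by
  simp [coordDiff, prefixExpect_update k F hj]

/-- The martingale increment of `F` at the coordinate `k`. -/
def increment (w : Fin n → S → ℝ) (k : Fin n) (F : (Fin n → S) → ℝ) : (Fin n → S) → ℝ :=
  fun s => prefixExpect w (k + 1) F s - prefixExpect w k F s

lemma expect_sq_increment (hw1 : ∀ i, ∑ a, w i a = 1) (k : Fin n) (F : (Fin n → S) → ℝ) :
    expect w (fun s => increment w k F s ^ 2) =
      expect w (fun s => prefixExpect w (k + 1) F s ^ 2) -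
        expect w (fun s => prefixExpect w k F s ^ 2) := by
  simp only [increment, ← avg_prefixExpect_succ hw1 k]
  exact expect_sq_sub_avg hw1 k _

/-- The squared norms of the martingale increments add up to the variance. -/
lemma sum_expect_sq_increment (hw1 : ∀ i, ∑ a, w i a = 1) (F : (Fin n → S) → ℝ) :
    ∑ k, expect w (fun s => increment w k F s ^ 2) =
      expect w (fun s => F s ^ 2) - expect w F ^ 2 := by
  simp only [expect_sq_increment hw1]
  rw [Fin.sum_univ_eq_sum_range (fun k => expect w (fun s => prefixExpect w (k + 1) F s ^ 2) -
        expect w (fun s => prefixExpect w k F s ^ 2)), Finset.sum_range_sub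
        (fun k => expect w (fun s => prefixExpect w k F s ^ 2))]
  simp only [prefixExpect_last hw1, prefixExpect_zero, expect_const hw1]

/-- The energies in direction `j` of the martingale increments add up to at most the energy. -/
lemma sum_expect_sq_coordDiff_increment (hw : ∀ i a, 0 ≤ w i a) (hw1 : ∀ i, ∑ a, w i a = 1)
    (top bot : Fin n → S) (j : Fin n) (F : (Fin n → S) → ℝ) :
    ∑ k, expect w (fun s => coordDiff top bot j (increment w k F) s ^ 2) ≤
      expect w (fun s => coordDiff top bot j F s ^ 2) := by
  have step (k : Fin n) : expect w (fun s => coordDiff top bot j (increment w k F) s ^ 2) =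
      expect w (fun s => coordDiff top bot j (prefixExpect w (k + 1) F) s ^ 2) -
        expect w (fun s => coordDiff top bot j (prefixExpect w k F) s ^ 2) := by
    have hd (s) : coordDiff top bot j (increment w k F) s =
        coordDiff top bot j (prefixExpect w (k + 1) F) s -
          coordDiff top bot j (prefixExpect w k F) s := by
      simp only [coordDiff, increment]; ring
    rcases le_or_gt (k : ℕ) j with h | h
    · simp only [hd, coordDiff_prefixExpect_of_le top bot h, sub_zero]
      simp [expect]
    · simp only [hd, coordDiff_prefixExpect top bot h,
        coordDiff_prefixExpect top bot (Nat.lt_succ_of_lt h)]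
      exact expect_sq_increment hw1 k _
  simp only [step]
  rw [Fin.sum_univ_eq_sum_range (fun k =>
        expect w (fun s => coordDiff top bot j (prefixExpect w (k + 1) F) s ^ 2) -
        expect w (fun s => coordDiff top bot j (prefixExpect w k F) s ^ 2)), Finset.sum_range_sub
        (fun k => expect w (fun s => coordDiff top bot j (prefixExpect w k F) s ^ 2)),
        prefixExpect_last hw1]
  exact sub_le_self _ (expect_nonneg hw fun s => sq_nonneg _)

/-- A pointwise form of the variational formula for the entropy. -/
lemma mul_log_le {x t h : ℝ} (hx : 0 ≤ x) (ht : 0 < t) (hh : 0 < h) :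
    x * log h ≤ (x - t) ^ 2 / t + t * (h - 1) := by
  rcases hx.eq_or_lt with rfl | hx
  · simp only [zero_mul, zero_sub, even_two, Even.neg_pow]
    field_simp
    nlinarith
  have e : log h = log (h * t / x) + log (x / t) := by
    rw [← log_mul (by positivity) (by positivity)]
    congr 1
    field_simp
  have h1 := log_le_sub_one_of_pos (show 0 < h * t / x by positivity)
  have h2 := log_le_sub_one_of_pos (show 0 < x / t by positivity)
  calc x * log h ≤ x * ((h * t / x - 1) + (x / t - 1)) := by
        rw [e]; exact mul_le_mul_of_nonneg_left (add_le_add h1 h2) hx.le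
    _ = (x - t) ^ 2 / t + t * (h - 1) := by field_simp; ring

/-- Tensorised entropy bound. -/
lemma entropy_le_sum (hw : ∀ i a, 0 ≤ w i a) (hw1 : ∀ i, ∑ a, w i a = 1)
    {g : (Fin n → S) → ℝ} (hg : ∀ s, 0 < g s) {t : Fin n → (Fin n → S) → ℝ}
    (ht : ∀ k s, 0 < t k s) (htk : ∀ k s a, t k (Function.update s k a) = t k s) :
    expect w (fun s => g s * log (g s)) - expect w g * log (expect w g) ≤
      ∑ k, expect w (fun s => (g s - t k s) ^ 2 / t k s) := by
  obtain ⟨ε, hε, hεg⟩ : ∃ ε > 0, ∀ s, ε ≤ g s := by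
    rcases isEmpty_or_nonempty (Fin n → S) with h | h
    · exact ⟨1, one_pos, fun s => h.elim s⟩
    · obtain ⟨s₀, hs₀⟩ := Finite.exists_min g
      exact ⟨g s₀, hg _, hs₀⟩
  have hpos (k s) : 0 < prefixExpect w k g s :=
    hε.trans_le <| by
      rw [← expect_const hw1 ε]
      exact expect_mono hw fun t => hεg _
  have hstep (k : Fin n) : expect w (fun s => g s *
      (log (prefixExpect w (k + 1) g s) - log (prefixExpect w k g s))) ≤
        expect w (fun s => (g s - t k s) ^ 2 / t k s) := by
    have hzero : expect w (fun s => t k s *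
        (prefixExpect w (k + 1) g s / prefixExpect w k g s - 1)) = 0 := by
      have h1 := expect_mul_avg hw1 k (prefixExpect w (k + 1) g)
        (fun s => t k s / prefixExpect w k g s) (fun s a => by
          rw [htk, prefixExpect_update _ _ le_rfl])
      rw [avg_prefixExpect_succ hw1] at h1
      have e : (fun s => t k s * (prefixExpect w (k + 1) g s / prefixExpect w k g s - 1)) =
          fun s => t k s / prefixExpect w k g s * prefixExpect w (k + 1) g s -
            t k s / prefixExpect w k g s * prefixExpect w k g s := by
        ext s
        have := (hpos k s).ne'
        field_simp
      rw [e, expect_sub, h1, sub_self]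
    calc _ ≤ expect w (fun s => (g s - t k s) ^ 2 / t k s + t k s *
          (prefixExpect w (k + 1) g s / prefixExpect w k g s - 1)) := by
          refine expect_mono hw fun s => ?_
          rw [← log_div (hpos _ s).ne' (hpos _ s).ne']
          exact mul_log_le (hg s).le (ht k s) (div_pos (hpos _ s) (hpos _ s))
      _ = _ := by rw [expect_add, hzero, add_zero]
  refine le_trans (le_of_eq ?_) (Finset.sum_le_sum fun k _ => hstep k)
  rw [← expect_sum]
  have htel (s) : ∑ k : Fin n, g s *
      (log (prefixExpect w (k + 1) g s) - log (prefixExpect w k g s)) =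
        g s * log (g s) - log (expect w g) * g s := by
    rw [← Finset.mul_sum, Fin.sum_univ_eq_sum_range (fun k =>
      log (prefixExpect w (k + 1) g s) - log (prefixExpect w k g s)),
      Finset.sum_range_sub (fun k => log (prefixExpect w k g s)), prefixExpect_last hw1,
      prefixExpect_zero]
    ring
  simp only [htel]
  rw [expect_sub, expect_const_mul]
  ring

/-- Logarithmic Sobolev inequality for functions taking at most two values on every fibre. -/
lemma entropy_sq_le (hw : ∀ i a, 0 ≤ w i a) (hw1 : ∀ i, ∑ a, w i a = 1) (top bot : Fin n → S)
    {d : (Fin n → S) → ℝ}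
    (hd : ∀ j s, d s = d (Function.update s j (top j)) ∨ d s = d (Function.update s j (bot j))) :
    expect w (fun s => d s ^ 2 * log (d s ^ 2)) -
        expect w (fun s => d s ^ 2) * log (expect w (fun s => d s ^ 2)) ≤
      4 * ∑ j, expect w (fun s => coordDiff top bot j d s ^ 2) := by
  have hε (ε : ℝ) (hε : 0 < ε) : expect w (fun s => (d s ^ 2 + ε) * log (d s ^ 2 + ε)) -
        (expect w (fun s => d s ^ 2) + ε) * log (expect w (fun s => d s ^ 2) + ε) ≤
      4 * ∑ j, expect w (fun s => coordDiff top bot j d s ^ 2) := by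
    have h := entropy_le_sum hw hw1 (g := fun s => d s ^ 2 + ε) (fun s => by positivity)
      (t := fun j s => max (d (Function.update s j (top j)) ^ 2)
        (d (Function.update s j (bot j)) ^ 2) + ε)
      (fun j s => by positivity) (fun j s a => by simp)
    rw [expect_add, expect_const hw1] at h
    refine h.trans ?_
    rw [Finset.mul_sum]
    refine Finset.sum_le_sum fun j _ => ?_
    rw [← expect_const_mul]
    refine expect_mono hw fun s => ?_
    rw [div_le_iff₀ (by positivity)]
    have hd' := hd j s
    simp only [coordDiff]
    set x := d (Function.update s j (top j))
    set y := d (Function.update s j (bot j))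
    have key {p q : ℝ} (hpq : p ^ 2 ≤ q ^ 2) :
        (p ^ 2 + ε - (q ^ 2 + ε)) ^ 2 ≤ 4 * (q - p) ^ 2 * (q ^ 2 + ε) := by
      have h4 : (p + q) ^ 2 ≤ 4 * (q ^ 2 + ε) := by nlinarith [sq_nonneg (p - q)]
      calc _ = (q - p) ^ 2 * (p + q) ^ 2 := by ring
        _ ≤ (q - p) ^ 2 * (4 * (q ^ 2 + ε)) := by gcongr
        _ = _ := by ring
    rcases le_total (x ^ 2) (y ^ 2) with hxy | hxy
    · rw [max_eq_right hxy]
      rcases hd' with h | h <;> rw [h]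
      · have := key hxy; nlinarith
      · rw [sub_self, zero_pow two_ne_zero]; positivity
    · rw [max_eq_left hxy]
      rcases hd' with h | h <;> rw [h]
      · rw [sub_self, zero_pow two_ne_zero]; positivity
      · exact key hxy
  have hcont : Continuous fun ε : ℝ => expect w (fun s => (d s ^ 2 + ε) * log (d s ^ 2 + ε)) -
        (expect w (fun s => d s ^ 2) + ε) * log (expect w (fun s => d s ^ 2) + ε) := by
    have hc (c : ℝ) : Continuous fun ε : ℝ => (c + ε) * log (c + ε) :=
      continuous_mul_log.comp (continuous_const.add continuous_id)
    refine Continuous.sub ?_ (hc _)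
    exact continuous_finsetSum _ fun s _ => continuous_const.mul (hc _)
  have hlim := (hcont.tendsto 0).mono_left (nhdsWithin_le_nhds (s := Set.Ioi 0))
  have := le_of_tendsto hlim (eventually_nhdsWithin_of_forall fun ε h => hε ε h)
  simpa using this

/-- Lower bound on the entropy of `d ^ 2` in terms of the `L¹` and `L²` norms of `d`. -/
lemma le_entropy_sq (hw : ∀ i a, 0 ≤ w i a) (d : (Fin n → S) → ℝ) {a : ℝ} (ha : 0 < a) :
    expect w (fun s => d s ^ 2) * (1 - log a) - expect w (fun s => |d s|) ^ 2 / a ≤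
      expect w (fun s => d s ^ 2 * log (d s ^ 2)) -
        expect w (fun s => d s ^ 2) * log (expect w (fun s => d s ^ 2)) := by
  set v := expect w (fun s => d s ^ 2) with hv
  set l := expect w (fun s => |d s|)
  have hv0 : 0 ≤ v := expect_nonneg hw fun s => sq_nonneg _
  rcases hv0.eq_or_lt with h0 | hv0
  · have hz : expect w (fun s => d s ^ 2 * log (d s ^ 2)) = 0 := by
      have hterm := (Finset.sum_eq_zero_iff_of_nonneg fun s _ =>
        mul_nonneg (Finset.prod_nonneg fun i _ => hw i _) (sq_nonneg (d s))).1
          (hv.symm.trans h0.symm)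
      exact Finset.sum_eq_zero fun s hs => by rw [← mul_assoc, hterm s hs, zero_mul]
    rw [← h0, hz]
    have : 0 ≤ l ^ 2 / a := by positivity
    linarith
  · set r := √(v / a) with hr
    have hr0 : 0 < r := by positivity
    have hr2 : r ^ 2 = v / a := sq_sqrt (by positivity)
    have hpt (s) : (2 + log v - log a) * d s ^ 2 - 2 * r * |d s| ≤ d s ^ 2 * log (d s ^ 2) := by
      rcases eq_or_ne (d s) 0 with h | h
      · simp [h]
      have hd : 0 < |d s| := abs_pos.2 h
      have h1 := log_le_sub_one_of_pos (show 0 < r / |d s| by positivity)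
      rw [log_div hr0.ne' hd.ne'] at h1
      have h2 : 2 * log r = log v - log a := by
        rw [← log_div hv0.ne' ha.ne', ← hr2, log_pow]; norm_num
      have h3 : log (d s ^ 2) = 2 * log |d s| := by rw [log_pow, log_abs]; norm_num
      have h4 : d s ^ 2 * (r / |d s|) = r * |d s| := by
        rw [← sq_abs]; field_simp
      rw [h3]
      nlinarith [mul_le_mul_of_nonneg_left h1 (sq_nonneg (d s))]
    have hE := expect_mono hw hpt
    rw [expect_sub, expect_const_mul, expect_const_mul] at hE
    change (2 + log v - log a) * v - 2 * r * l ≤ _ at hE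
    have hy : 2 * r * l ≤ v + l ^ 2 / a := by
      have := sq_nonneg (√v - l / √a)
      have e1 : √v * (l / √a) = r * l := by rw [hr, sqrt_div hv0.le]; ring
      have e2 : (l / √a) ^ 2 = l ^ 2 / a := by rw [div_pow, sq_sqrt ha.le]
      have e3 : √v ^ 2 = v := sq_sqrt hv0.le
      nlinarith
    nlinarith

/-- A Falik–Samorodnitsky type inequality for monotone Boolean functions on a product space that
depend on every coordinate `j` only through a bit `c j`. -/
theorem variance_le_influence (hw : ∀ i a, 0 ≤ w i a) (hw1 : ∀ i, ∑ a, w i a = 1)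
    (top bot : Fin n → S) (c : Fin n → (Fin n → S) → Bool)
    (hc : ∀ j s s', (∀ i ≤ j, s i = s' i) → c j s = c j s') {f : (Fin n → S) → ℝ}
    (hf : ∀ j s, f s = f (Function.update s j (if c j s then top j else bot j)))
    (hf01 : ∀ s, f s = 0 ∨ f s = 1) (hmono : ∀ j s, 0 ≤ coordDiff top bot j f s)
    {K : ℝ} (hK : ∀ j, expect w (coordDiff top bot j f) ≤ K) {a : ℝ} (ha : 0 < a) :
    expect w f * (1 - expect w f) * (1 - log a) - n * K ^ 2 / a ≤ 4 * (n * K) := by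
  have htwo (k : ℕ) (j : Fin n) (s : Fin n → S) : prefixExpect w k f s =
      prefixExpect w k f (Function.update s j (if c j s then top j else bot j)) := by
    rcases le_or_gt k j with h | h
    · rw [prefixExpect_update _ _ h]
    · simp only [prefixExpect]
      congr 1
      ext t
      rw [splice_update h, hf j (splice k s t), hc j (splice k s t) s]
      intro i hi
      have : (i : ℕ) < k := lt_of_le_of_lt hi h
      simp [splice, this]
  have hL1 (k : Fin n) : expect w (fun s => |increment w k f s|) ≤ K := by
    refine le_trans ?_ (hK k)
    have hle (s) : |increment w k f s| ≤ coordDiff top bot k (prefixExpect w (k + 1) f) s := by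
      have hnn : 0 ≤ coordDiff top bot k (prefixExpect w (k + 1) f) s := by
        rw [coordDiff_prefixExpect _ _ (Nat.lt_succ_self _)]
        exact expect_nonneg hw fun t => hmono _ _
      rw [increment, ← avg_prefixExpect_succ hw1]
      set F := prefixExpect w (k + 1) f
      have hval (b : S) : F (Function.update s k b) = F (Function.update s k (top k)) ∨
          F (Function.update s k b) = F (Function.update s k (bot k)) := by
        have := htwo (k + 1) k (Function.update s k b)
        rw [Function.update_idem] at this
        split_ifs at this
        · exact Or.inl this
        · exact Or.inr this
      simp only [coordDiff] at hnn ⊢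
      set x := F (Function.update s k (top k))
      set y := F (Function.update s k (bot k))
      have hb (b : S) : y ≤ F (Function.update s k b) ∧ F (Function.update s k b) ≤ x := by
        rcases hval b with h | h <;> rw [h] <;> constructor <;> linarith
      have hs := hb (s k)
      rw [Function.update_eq_self] at hs
      have hlow : y ≤ avg w k F s := by
        calc y = ∑ b, w k b * y := by rw [← Finset.sum_mul, hw1, one_mul]
          _ ≤ _ := Finset.sum_le_sum fun b _ => mul_le_mul_of_nonneg_left (hb b).1 (hw k b)
      have hhigh : avg w k F s ≤ x := by
        calc _ ≤ ∑ b, w k b * x :=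
              Finset.sum_le_sum fun b _ => mul_le_mul_of_nonneg_left (hb b).2 (hw k b)
          _ = x := by rw [← Finset.sum_mul, hw1, one_mul]
      rw [abs_le]
      constructor <;> linarith
    refine (expect_mono hw hle).trans (le_of_eq ?_)
    rw [coordDiff_prefixExpect _ _ (Nat.lt_succ_self _), expect_prefixExpect hw1 _ k.2]
  have hsq (j : Fin n) : expect w (fun s => coordDiff top bot j f s ^ 2) ≤ K := by
    refine le_trans (le_of_eq ?_) (hK j)
    congr 1
    ext s
    have h0 := hmono j s
    simp only [coordDiff] at h0 ⊢
    rcases hf01 (Function.update s j (top j)) with h | h <;>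
      rcases hf01 (Function.update s j (bot j)) with h' | h' <;>
      rw [h, h'] at h0 ⊢ <;> linarith
  have hent (k : Fin n) : expect w (fun s => increment w k f s ^ 2) * (1 - log a) - K ^ 2 / a ≤
      4 * ∑ j, expect w (fun s => coordDiff top bot j (increment w k f) s ^ 2) := by
    have h1 := le_entropy_sq hw (increment w k f) ha
    have h2 := entropy_sq_le hw hw1 top bot (d := increment w k f) fun j s => by
      have e1 := htwo k j s
      have e2 := htwo (k + 1) j s
      simp only [increment]
      split_ifs at e1 e2
      · left; rw [← e1, ← e2]
      · right; rw [← e1, ← e2]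
    have h3 : expect w (fun s => |increment w k f s|) ^ 2 / a ≤ K ^ 2 / a := by
      have := expect_nonneg hw fun s => abs_nonneg (increment w k f s)
      gcongr
      exact hL1 k
    linarith
  have hsum := Finset.sum_le_sum fun k (_ : k ∈ Finset.univ) => hent k
  rw [Finset.sum_sub_distrib, ← Finset.sum_mul, sum_expect_sq_increment hw1, ← Finset.mul_sum,
    Finset.sum_comm] at hsum
  have hen := Finset.sum_le_sum fun j (_ : j ∈ Finset.univ) =>
    (sum_expect_sq_coordDiff_increment hw hw1 top bot j f).trans (hsq j)
  have hff : (fun s => f s ^ 2) = f := by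
    ext s; rcases hf01 s with h | h <;> rw [h] <;> norm_num
  rw [hff] at hsum
  simp only [Finset.sum_const, Finset.card_univ, Fintype.card_fin, nsmul_eq_mul] at hsum hen
  calc _ = (expect w f - expect w f ^ 2) * (1 - log a) - n * (K ^ 2 / a) := by ring
    _ ≤ _ := hsum.trans (by linarith)

end ProductSpace

section Coupling

variable {n : ℕ}

/-- Sum of `H` over the configurations that agree with `η` on the coordinates below `k`. -/
def prefixSum (H : (Fin n → Bool) → ℝ) (k : ℕ) (η : Fin n → Bool) : ℝ :=
  ∑ ω with ∀ i : Fin n, (i : ℕ) < k → ω i = η i, H ω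

lemma prefixSum_zero (H : (Fin n → Bool) → ℝ) (η : Fin n → Bool) :
    prefixSum H 0 η = ∑ ω, H ω := by
  simp [prefixSum]

lemma prefixSum_last (H : (Fin n → Bool) → ℝ) (η : Fin n → Bool) : prefixSum H n η = H η := by
  have : (Finset.univ.filter fun ω : Fin n → Bool => ∀ i : Fin n, (i : ℕ) < n → ω i = η i) =
      {η} := by
    ext ω; simp [funext_iff]
  rw [prefixSum, this, Finset.sum_singleton]

lemma agree_succ_iff (k : Fin n) (η ω : Fin n → Bool) (b : Bool) :
    (∀ i : Fin n, (i : ℕ) < k + 1 → ω i = Function.update η k b i) ↔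
      (∀ i : Fin n, (i : ℕ) < k → ω i = η i) ∧ ω k = b := by
  constructor
  · intro h
    refine ⟨fun i hi => ?_, by simpa using h k (Nat.lt_succ_self _)⟩
    have hik : i ≠ k := by rintro rfl; omega
    simpa [hik] using h i (Nat.lt_succ_of_lt hi)
  · rintro ⟨h, hk⟩ i hi
    rcases eq_or_ne i k with rfl | hik
    · simpa using hk
    · have : (i : ℕ) ≠ k := fun e => hik (Fin.ext e)
      simpa [hik] using h i (by omega)

lemma prefixSum_split (H : (Fin n → Bool) → ℝ) (k : Fin n) (η : Fin n → Bool) :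
    prefixSum H k η = prefixSum H (k + 1) (Function.update η k true) +
      prefixSum H (k + 1) (Function.update η k false) := by
  simp only [prefixSum, agree_succ_iff]
  rw [← Finset.sum_filter_add_sum_filter_not _ fun ω : Fin n → Bool => ω k = true]
  simp only [Finset.filter_filter, Bool.not_eq_true]

lemma prefixSum_pos {ν : (Fin n → Bool) → ℝ} (hν : ∀ ω, 0 < ν ω) (k : ℕ) (η : Fin n → Bool) :
    0 < prefixSum ν k η :=
  Finset.sum_pos (fun ω _ => hν ω) ⟨η, by simp⟩

/-- Conditional probability that the spin `j` is up given that the previous ones agree with `η`. -/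
noncomputable def condUp (ν : (Fin n → Bool) → ℝ) (j : Fin n) (η : Fin n → Bool) : ℝ :=
  prefixSum ν (j + 1) (Function.update η j true) / prefixSum ν j η

lemma condUp_pos {ν : (Fin n → Bool) → ℝ} (hν : ∀ ω, 0 < ν ω) (j : Fin n) (η : Fin n → Bool) :
    0 < condUp ν j η :=
  div_pos (prefixSum_pos hν _ _) (prefixSum_pos hν _ _)

lemma condUp_lt_one {ν : (Fin n → Bool) → ℝ} (hν : ∀ ω, 0 < ν ω) (j : Fin n)
    (η : Fin n → Bool) : condUp ν j η < 1 := by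
  rw [condUp, div_lt_one (prefixSum_pos hν _ _), prefixSum_split]
  exact lt_add_of_pos_right _ (prefixSum_pos hν _ _)

/-- Under the lattice condition the conditional probabilities are monotone. -/
lemma condUp_mono {ν : (Fin n → Bool) → ℝ} (hν : ∀ ω, 0 < ν ω)
    (hlat : ∀ a b, ν a * ν b ≤ ν (a ⊓ b) * ν (a ⊔ b)) (j : Fin n) : Monotone (condUp ν j) := by
  intro η η' hη
  have key : prefixSum ν (j + 1) (Function.update η j true) *
      prefixSum ν (j + 1) (Function.update η' j false) ≤
        prefixSum ν (j + 1) (Function.update η j false) *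
          prefixSum ν (j + 1) (Function.update η' j true) := by
    simp only [prefixSum, agree_succ_iff]
    have h0 : (0 : (Fin n → Bool) → ℝ) ≤ ν := fun ω => (hν ω).le
    refine (four_functions_theorem ν ν ν ν h0 h0 h0 h0 hlat _ _).trans ?_
    refine mul_le_mul ?_ ?_ (Finset.sum_nonneg fun ω _ => (hν ω).le)
      (Finset.sum_nonneg fun ω _ => (hν ω).le)
    · refine Finset.sum_le_sum_of_subset_of_nonneg ?_ fun ω _ _ => (hν ω).le
      intro ω hω
      obtain ⟨a, ha, b, hb, rfl⟩ := Finset.mem_infs.1 hω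
      simp only [Finset.mem_filter, Finset.mem_univ, true_and] at ha hb ⊢
      refine ⟨fun i hi => ?_, by simp [ha.2, hb.2]⟩
      rw [Pi.inf_apply, ha.1 i hi, hb.1 i hi]
      exact inf_eq_left.2 (hη i)
    · refine Finset.sum_le_sum_of_subset_of_nonneg ?_ fun ω _ _ => (hν ω).le
      intro ω hω
      obtain ⟨a, ha, b, hb, rfl⟩ := Finset.mem_sups.1 hω
      simp only [Finset.mem_filter, Finset.mem_univ, true_and] at ha hb ⊢
      refine ⟨fun i hi => ?_, by simp [ha.2, hb.2]⟩
      rw [Pi.sup_apply, ha.1 i hi, hb.1 i hi]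
      exact sup_eq_right.2 (hη i)
  rw [condUp, condUp, div_le_div_iff₀ (prefixSum_pos hν _ _) (prefixSum_pos hν _ _),
    prefixSum_split ν j η, prefixSum_split ν j η']
  nlinarith

/-- Weights on a finite set of nonnegative reals whose distribution function is the identity. -/
lemma exists_weights (P : Finset ℝ) (hP : ∀ a ∈ P, 0 ≤ a) :
    ∃ w : ℝ → ℝ, (∀ a, 0 ≤ w a) ∧ ∀ q ∈ P, ∑ a ∈ P with a ≤ q, w a = q := by
  induction P using Finset.induction_on_max with
  | empty => exact ⟨0, by simp, by simp⟩
  | insert m P hm ih =>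
    obtain ⟨w, hw, hwq⟩ := ih fun a ha => hP a (Finset.mem_insert_of_mem ha)
    have hmP : m ∉ P := fun h => lt_irrefl _ (hm m h)
    have hle : ∑ a ∈ P, w a ≤ m := by
      rcases P.eq_empty_or_nonempty with rfl | hne
      · simpa using hP m (by simp)
      · have := hwq _ (P.max'_mem hne)
        rw [Finset.filter_true_of_mem fun a ha => P.le_max' a ha] at this
        rw [this]
        exact (hm _ (P.max'_mem hne)).le
    have hsum (Q : Finset ℝ) (hQ : Q ⊆ P) :
        ∑ a ∈ Q, Function.update w m (m - ∑ a ∈ P, w a) a = ∑ a ∈ Q, w a :=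
      Finset.sum_congr rfl fun a ha =>
        Function.update_of_ne (ne_of_mem_of_not_mem (hQ ha) hmP) _ _
    refine ⟨Function.update w m (m - ∑ a ∈ P, w a), fun a => ?_, fun q hq => ?_⟩
    · rcases eq_or_ne a m with rfl | h
      · simpa using hle
      · simpa [h] using hw a
    · rcases Finset.mem_insert.1 hq with rfl | hq
      · rw [Finset.filter_true_of_mem fun a ha => ?_, Finset.sum_insert hmP, hsum P subset_rfl]
        · simp
        · rcases Finset.mem_insert.1 ha with rfl | ha
          · exact le_rfl
          · exact (hm a ha).le
      · rw [Finset.filter_insert, if_neg (not_le.2 (hm q hq)), hsum _ (Finset.filter_subset _ _)]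
        exact hwq q hq

variable {S : Type} [LinearOrder S]

/-- The spins generated from `s` one after the other: the spin `j` is up if `s j` is at most the
threshold `q j` of the spins before it. Only the first `k` spins are generated. -/
def partialSpins (q : Fin n → (Fin n → Bool) → S) (s : Fin n → S) : ℕ → Fin n → Bool
  | 0 => fun _ => false
  | k + 1 =>
    if h : k < n then
      Function.update (partialSpins q s k) ⟨k, h⟩
        (decide (s ⟨k, h⟩ ≤ q ⟨k, h⟩ (partialSpins q s k)))
    else partialSpins q s k

/-- The spins generated from `s`. -/
def spins (q : Fin n → (Fin n → Bool) → S) (s : Fin n → S) : Fin n → Bool :=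
  partialSpins q s n

lemma partialSpins_succ (q : Fin n → (Fin n → Bool) → S) (s : Fin n → S) (k : Fin n) :
    partialSpins q s (k + 1) = Function.update (partialSpins q s k) k
      (decide (s k ≤ q k (partialSpins q s k))) := by
  simp [partialSpins]

lemma partialSpins_apply (q : Fin n → (Fin n → Bool) → S) (s : Fin n → S) (j : Fin n) (k : ℕ)
    (hk : (j : ℕ) < k) :
    partialSpins q s k j = decide (s j ≤ q j (partialSpins q s j)) := by
  induction k, hk using Nat.le_induction with
  | base => rw [Nat.succ_eq_add_one, partialSpins_succ, Function.update_self]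
  | succ k hk ih =>
    by_cases h : k < n
    · have hj : j ≠ ⟨k, h⟩ := by rintro rfl; simp at hk
      rw [show k + 1 = ((⟨k, h⟩ : Fin n) : ℕ) + 1 from rfl, partialSpins_succ,
        Function.update_of_ne hj, ih]
    · simpa [partialSpins, h] using ih

lemma partialSpins_congr (q : Fin n → (Fin n → Bool) → S) {s s' : Fin n → S} (k : ℕ)
    (h : ∀ i : Fin n, (i : ℕ) < k → s i = s' i) : partialSpins q s k = partialSpins q s' k := by
  induction k with
  | zero => rfl
  | succ k ih =>
    have ih := ih fun i hi => h i (Nat.lt_succ_of_lt hi)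
    by_cases hk : k < n
    · simp [partialSpins, hk, ih, h ⟨k, hk⟩ (Nat.lt_succ_self _)]
    · simp [partialSpins, hk, ih]

lemma spins_apply (q : Fin n → (Fin n → Bool) → S) (s : Fin n → S) (j : Fin n) :
    spins q s j = decide (s j ≤ q j (partialSpins q s j)) :=
  partialSpins_apply q s j n j.2

lemma antitone_partialSpins {q : Fin n → (Fin n → Bool) → S} (hq : ∀ j, Monotone (q j)) (k : ℕ) :
    Antitone fun s => partialSpins q s k := by
  intro s s' hs
  induction k with
  | zero => exact le_rfl
  | succ k ih =>
    by_cases hk : k < n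
    · simp only [partialSpins, hk, dite_true]
      refine update_le_update_iff.2 ⟨?_, fun j _ => ih j⟩
      rw [Bool.le_iff_imp]
      simp only [decide_eq_true_eq]
      exact fun h => (hs _).trans (h.trans (hq _ ih))
    · simpa [partialSpins, hk] using ih

lemma spins_update {q : Fin n → (Fin n → Bool) → S} {top bot : S} (htop : ∀ j η, top ≤ q j η)
    (hbot : ∀ j η, q j η < bot) (j : Fin n) (s : Fin n → S) :
    spins q (Function.update s j (if spins q s j then top else bot)) = spins q s := by
  suffices H : ∀ k, partialSpins q (Function.update s j (if spins q s j then top else bot)) k =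
      partialSpins q s k from H n
  intro k
  induction k with
  | zero => rfl
  | succ k ih =>
    by_cases hk : k < n
    · simp only [partialSpins, hk, dite_true, ih]
      congr 1
      rcases eq_or_ne (⟨k, hk⟩ : Fin n) j with rfl | hj
      · have e := spins_apply q s ⟨k, hk⟩
        simp only at e
        rw [← e, Function.update_self]
        cases h : spins q s ⟨k, hk⟩
        · simp [hbot]
        · simp [htop]
      · rw [Function.update_of_ne hj]
    · simpa [partialSpins, hk] using ih

variable [Fintype S]

/-- The law of the generated spins is `ν` if the thresholds have the right probabilities. -/
lemma expect_comp_spins {ν : (Fin n → Bool) → ℝ} (hν : ∀ ω, 0 < ν ω) (hν1 : ∑ ω, ν ω = 1)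
    {w : S → ℝ} (hw1 : ∑ a, w a = 1) {q : Fin n → (Fin n → Bool) → S}
    (hwq : ∀ j η, ∑ a with a ≤ q j η, w a = condUp ν j η) (H : (Fin n → Bool) → ℝ) :
    expect (fun _ => w) (fun s => H (spins q s)) = ∑ ω, ν ω * H ω := by
  have key (k : ℕ) (hk : k ≤ n) (s : Fin n → S) :
      prefixExpect (fun _ => w) k (fun s => H (spins q s)) s =
        prefixSum (fun ω => ν ω * H ω) k (partialSpins q s k) /
          prefixSum ν k (partialSpins q s k) := by
    induction hk using Nat.decreasingInduction generalizing s with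
    | self =>
      rw [prefixExpect_last fun _ => hw1, prefixSum_last, prefixSum_last]
      exact (mul_div_cancel_left₀ _ (hν _).ne').symm
    | of_succ k hk ih =>
      have hpart (a : S) : partialSpins q (Function.update s ⟨k, hk⟩ a) (k + 1) =
          Function.update (partialSpins q s k) ⟨k, hk⟩
            (decide (a ≤ q ⟨k, hk⟩ (partialSpins q s k))) := by
        have := partialSpins_succ q (Function.update s ⟨k, hk⟩ a) ⟨k, hk⟩
        simp only at this
        rw [this, Function.update_self, partialSpins_congr (s' := s) q k]
        intro i hi
        have : i ≠ ⟨k, hk⟩ := by rintro rfl; simp at hi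
        simp [this]
      have hav := avg_prefixExpect_succ (w := fun _ : Fin n => w) (fun _ => hw1) ⟨k, hk⟩
        fun s => H (spins q s)
      simp only at hav
      rw [← hav]
      simp only [avg, ih, hpart]
      set η := partialSpins q s k
      set R : Bool → ℝ := fun b =>
        prefixSum (fun ω => ν ω * H ω) (k + 1) (Function.update η ⟨k, hk⟩ b) /
          prefixSum ν (k + 1) (Function.update η ⟨k, hk⟩ b) with hR
      have hsum : ∑ a, w a * R (decide (a ≤ q ⟨k, hk⟩ η)) =
          condUp ν ⟨k, hk⟩ η * R true + (1 - condUp ν ⟨k, hk⟩ η) * R false := by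
        have h1 := hwq ⟨k, hk⟩ η
        have h2 : ∑ a with ¬ a ≤ q ⟨k, hk⟩ η, w a = 1 - condUp ν ⟨k, hk⟩ η := by
          rw [← h1, ← hw1, ← Finset.sum_filter_add_sum_filter_not Finset.univ
            fun a => a ≤ q ⟨k, hk⟩ η]
          ring
        rw [← h2, ← h1, Finset.sum_mul, Finset.sum_mul,
          ← Finset.sum_filter_add_sum_filter_not Finset.univ fun a => a ≤ q ⟨k, hk⟩ η]
        congr 1
        · refine Finset.sum_congr rfl fun a ha => ?_
          rw [decide_eq_true (Finset.mem_filter.1 ha).2]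
        · refine Finset.sum_congr rfl fun a ha => ?_
          rw [decide_eq_false (Finset.mem_filter.1 ha).2]
      refine hsum.trans ?_
      have hs1 := prefixSum_split ν ⟨k, hk⟩ η
      have hs2 := prefixSum_split (fun ω => ν ω * H ω) ⟨k, hk⟩ η
      simp only at hs1 hs2
      have p0 := prefixSum_pos hν k η
      have p1 := prefixSum_pos hν (k + 1) (Function.update η ⟨k, hk⟩ true)
      have p2 := prefixSum_pos hν (k + 1) (Function.update η ⟨k, hk⟩ false)
      have hc : 1 - condUp ν ⟨k, hk⟩ η =
          prefixSum ν (k + 1) (Function.update η ⟨k, hk⟩ false) / prefixSum ν k η := by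
        rw [condUp, eq_div_iff p0.ne', sub_mul, div_mul_cancel₀ _ p0.ne', one_mul, hs1]
        ring
      rw [hc, condUp, hs2, hR]
      field_simp
  have h0 := fun s => key 0 (Nat.zero_le _) s
  simp only [prefixExpect_zero, prefixSum_zero, hν1, div_one] at h0
  rcases isEmpty_or_nonempty S with hS | ⟨⟨a⟩⟩
  · simp at hw1
  · exact h0 fun _ => a

/-- Harris' inequality for functions with values in the unit interval. -/
lemma expect_mul_expect_le {w : S → ℝ} (hw : ∀ a, 0 ≤ w a) (hw1 : ∑ a, w a = 1)
    {F H : (Fin n → S) → ℝ} (hF : Antitone F) (hH : Antitone H) (hF1 : ∀ s, F s ≤ 1)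
    (hH1 : ∀ s, H s ≤ 1) :
    expect (fun _ => w) F * expect (fun _ => w) H ≤ expect (fun _ => w) fun s => F s * H s := by
  have h := fkg (μ := fun s : Fin n → S => ∏ i, w (s i)) (f := fun s => 1 - F s)
    (g := fun s => 1 - H s) (fun s => Finset.prod_nonneg fun i _ => hw _)
    (fun s => sub_nonneg.2 (hF1 s))
    (fun s => sub_nonneg.2 (hH1 s)) (fun s t hst => sub_le_sub_left (hF hst) 1)
    (fun s t hst => sub_le_sub_left (hH hst) 1) (fun s t => by
      rw [← Finset.prod_mul_distrib, ← Finset.prod_mul_distrib]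
      refine le_of_eq (Finset.prod_congr rfl fun i _ => ?_)
      rcases le_total (s i) (t i) with h | h <;> simp [h, mul_comm])
  change expect (fun _ => w) (fun s => 1 - F s) * expect (fun _ => w) (fun s => 1 - H s) ≤
    (∑ s : Fin n → S, ∏ i, w (s i)) * expect (fun _ => w) (fun s => (1 - F s) * (1 - H s)) at h
  have hone : ∑ s : Fin n → S, ∏ i, w (s i) = 1 := by
    simpa [expect] using expect_const (n := n) (w := fun _ => w) (fun _ => hw1) 1
  have e : (fun s => (1 - F s) * (1 - H s)) = fun s => ((1 - F s) - H s) + F s * H s := by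
    ext s; ring
  rw [hone, e, expect_add, expect_sub, expect_sub (fun _ => 1), expect_sub (fun s => 1 - F s),
    expect_sub (fun _ => 1), expect_const fun _ => hw1] at h
  linarith

/-- Influence inequality for the law `ν` of spins generated from independent variables. -/
lemma variance_le_of_spins {ν : (Fin n → Bool) → ℝ} (hν : ∀ ω, 0 < ν ω) (hν1 : ∑ ω, ν ω = 1)
    {w : S → ℝ} (hw : ∀ a, 0 ≤ w a) (hw1 : ∑ a, w a = 1) {q : Fin n → (Fin n → Bool) → S}
    (hwq : ∀ j η, ∑ a with a ≤ q j η, w a = condUp ν j η) (hq : ∀ j, Monotone (q j))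
    {top bot : S} (htop : ∀ j η, top ≤ q j η) (hbot : ∀ j η, q j η < bot) (htb : top ≤ bot)
    {F : (Fin n → Bool) → ℝ} (hF01 : ∀ ω, F ω = 0 ∨ F ω = 1) (hF : Monotone F) {K : ℝ}
    (hK : ∀ j, (∑ ω with ω j = true, ν ω * F ω) / (∑ ω with ω j = true, ν ω) -
      (∑ ω with ¬ ω j = true, ν ω * F ω) / (∑ ω with ¬ ω j = true, ν ω) ≤ K)
    {a : ℝ} (ha : 0 < a) :
    (∑ ω, ν ω * F ω) * (1 - ∑ ω, ν ω * F ω) * (1 - log a) - n * K ^ 2 / a ≤ 4 * (n * K) := by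
  have hlaw := expect_comp_spins hν hν1 hw1 hwq
  let f : (Fin n → S) → ℝ := fun s => F (spins q s)
  have hanti : Antitone f := fun s s' h => hF (antitone_partialSpins hq n h)
  have hf (j : Fin n) (s : Fin n → S) :
      f s = f (Function.update s j (if spins q s j then top else bot)) := by
    simp only [f]
    rw [spins_update htop hbot]
  have hF1 (ω) : F ω ≤ 1 := by rcases hF01 ω with h | h <;> norm_num [h]
  have hupd (j : Fin n) (b : S) : Antitone fun s => f (Function.update s j b) := fun s s' h =>
    hanti (update_le_update_iff.2 ⟨le_rfl, fun i _ => h i⟩)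
  have hbit (j : Fin n) : Antitone fun s => if spins q s j = true then (1 : ℝ) else 0 := by
    intro s s' h
    have := Bool.le_iff_imp.1 (antitone_partialSpins hq n h j)
    change spins q s' j = true → spins q s j = true at this
    dsimp only
    by_cases h' : spins q s' j = true
    · rw [if_pos h', if_pos (this h')]
    · rw [if_neg h']
      split_ifs <;> norm_num
  have hinf (j : Fin n) :
      expect (fun _ => w) (coordDiff (fun _ => top) (fun _ => bot) j f) ≤ K := by
    refine le_trans ?_ (hK j)
    have hup := hlaw fun ω => if ω j = true then F ω else 0
    have hq1 := hlaw fun ω => if ω j = true then 1 else 0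
    have hall := hlaw F
    have hT : ∑ ω, ν ω * (if ω j = true then F ω else 0) = ∑ ω with ω j = true, ν ω * F ω := by
      rw [Finset.sum_filter]
      exact Finset.sum_congr rfl fun ω _ => by split_ifs <;> simp
    have hT1 : ∑ ω, ν ω * (if ω j = true then 1 else 0) = ∑ ω with ω j = true, ν ω := by
      rw [Finset.sum_filter]
      exact Finset.sum_congr rfl fun ω _ => by split_ifs <;> simp
    have hcomp := Finset.sum_filter_add_sum_filter_not Finset.univ (fun ω => ω j = true)
      fun ω => ν ω * F ω
    have hcomp1 := Finset.sum_filter_add_sum_filter_not Finset.univ (fun ω => ω j = true) ν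
    have hup_pos : 0 < ∑ ω with ω j = true, ν ω :=
      Finset.sum_pos (fun ω _ => hν ω) ⟨fun _ => true, by simp⟩
    have hdown_pos : 0 < ∑ ω with ¬ ω j = true, ν ω :=
      Finset.sum_pos (fun ω _ => hν ω) ⟨fun _ => false, by simp⟩
    rw [hT] at hup
    rw [hT1] at hq1
    rw [hν1] at hcomp1
    have hh1 := expect_mul_expect_le hw hw1 (hupd j top) (hbit j) (fun s => hF1 _)
      (fun s => by split_ifs <;> norm_num)
    have hh0 := expect_mul_expect_le hw hw1 (hupd j bot) (hbit j) (fun s => hF1 _)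
      (fun s => by split_ifs <;> norm_num)
    have e1 : (fun s => f (Function.update s j top) * if spins q s j = true then (1 : ℝ) else 0) =
        fun s => if spins q s j = true then F (spins q s) else 0 := by
      ext s
      have := hf j s
      split_ifs at this ⊢
      · rw [mul_one, ← this]
      · rw [mul_zero]
    have e0 : (fun s => f s - if spins q s j = true then F (spins q s) else 0) =
        fun s => f (Function.update s j bot) -
          f (Function.update s j bot) * if spins q s j = true then (1 : ℝ) else 0 := by
      ext s
      have := hf j s
      split_ifs at this ⊢
      · simp [f]
      · rw [mul_zero, ← this, sub_zero]
    have e0' := congrArg (expect fun _ => w) e0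
    rw [expect_sub, expect_sub, hup] at e0'
    change expect _ f = _ at hall
    rw [hall] at e0'
    rw [e1, hup, hq1] at hh1
    rw [hq1] at hh0
    set x1 := expect (fun _ => w) fun s => f (Function.update s j top)
    set x0 := expect (fun _ => w) fun s => f (Function.update s j bot)
    have hI : expect (fun _ => w) (coordDiff (fun _ => top) (fun _ => bot) j f) = x1 - x0 :=
      expect_sub _ _
    rw [hI]
    have b1 : x1 ≤ (∑ ω with ω j = true, ν ω * F ω) / ∑ ω with ω j = true, ν ω := by
      rwa [le_div_iff₀ hup_pos]
    have b0 : (∑ ω with ¬ ω j = true, ν ω * F ω) / ∑ ω with ¬ ω j = true, ν ω ≤ x0 := by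
      rw [div_le_iff₀ hdown_pos]
      have : ∑ ω with ¬ ω j = true, ν ω = 1 - ∑ ω with ω j = true, ν ω := by linarith
      rw [this]
      linarith
    linarith
  have main := variance_le_influence (w := fun _ : Fin n => w) (fun _ => hw) (fun _ => hw1)
    (fun _ => top) (fun _ => bot) (fun j s => spins q s j) (fun j s s' h => by
      rw [spins_apply, spins_apply, h j le_rfl, partialSpins_congr q (s' := s')]
      exact fun i hi => h i (le_of_lt hi)) hf (fun s => hF01 _) (fun j s => by
      rw [coordDiff, sub_nonneg]
      refine hanti (update_le_update_iff.2 ⟨?_, fun i _ => le_rfl⟩)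
      exact htb) hinf ha
  have hall : expect (fun _ => w) f = ∑ ω, ν ω * F ω := hlaw F
  rwa [hall] at main


end Coupling

/-- Influence inequality for positive measures on `Fin n → Bool` satisfying the FKG lattice
condition. -/
theorem variance_le_of_lattice {n : ℕ} {ν : (Fin n → Bool) → ℝ} (hν : ∀ ω, 0 < ν ω)
    (hν1 : ∑ ω, ν ω = 1) (hlat : ∀ a b, ν a * ν b ≤ ν (a ⊓ b) * ν (a ⊔ b))
    {F : (Fin n → Bool) → ℝ} (hF01 : ∀ ω, F ω = 0 ∨ F ω = 1) (hF : Monotone F) {K : ℝ}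
    (hK : ∀ j, (∑ ω with ω j = true, ν ω * F ω) / (∑ ω with ω j = true, ν ω) -
      (∑ ω with ¬ ω j = true, ν ω * F ω) / (∑ ω with ¬ ω j = true, ν ω) ≤ K)
    {a : ℝ} (ha : 0 < a) :
    (∑ ω, ν ω * F ω) * (1 - ∑ ω, ν ω * F ω) * (1 - log a) - n * K ^ 2 / a ≤ 4 * (n * K) := by
  classical
  set P : Finset ℝ := insert 0 (insert 1
    ((Finset.univ : Finset (Fin n × (Fin n → Bool))).image fun x => condUp ν x.1 x.2)) with hP
  have hP0 : ∀ x ∈ P, 0 ≤ x ∧ x ≤ 1 := by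
    intro x hx
    simp only [hP, Finset.mem_insert, Finset.mem_image, Finset.mem_univ, true_and] at hx
    rcases hx with rfl | rfl | ⟨y, rfl⟩
    · norm_num
    · norm_num
    · exact ⟨(condUp_pos hν _ _).le, (condUp_lt_one hν _ _).le⟩
  obtain ⟨w', hw', hwq'⟩ := exists_weights P fun x hx => (hP0 x hx).1
  let w : P → ℝ := fun x => w' x
  have hw (x : P) : 0 ≤ w x := hw' x
  have hwle (r : ℝ) (hr : r ∈ P) : ∑ x : P with x ≤ ⟨r, hr⟩, w x = r := by
    refine Eq.trans ?_ (hwq' r hr)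
    rw [Finset.sum_filter, Finset.sum_filter, ← Finset.sum_coe_sort P]
    rfl
  have h1P : (1 : ℝ) ∈ P := by simp [hP]
  have h0P : (0 : ℝ) ∈ P := by simp [hP]
  have hw1 : ∑ x, w x = 1 := by
    have := hwle 1 h1P
    rwa [Finset.filter_true_of_mem fun (x : P) _ => show x ≤ ⟨1, h1P⟩ from (hP0 x x.2).2] at this
  have hcP (j : Fin n) (η : Fin n → Bool) : condUp ν j η ∈ P :=
    Finset.mem_insert_of_mem <| Finset.mem_insert_of_mem <|
      Finset.mem_image.2 ⟨(j, η), Finset.mem_univ _, rfl⟩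
  let q : Fin n → (Fin n → Bool) → P := fun j η => ⟨condUp ν j η, hcP j η⟩
  have hq (j) : Monotone (q j) := fun η η' h => condUp_mono hν hlat j h
  exact variance_le_of_spins hν hν1 hw hw1 (fun j η => hwle _ (hcP j η)) hq (top := ⟨0, h0P⟩)
    (bot := ⟨1, h1P⟩) (fun j η => (condUp_pos hν j η).le) (fun j η => condUp_lt_one hν j η)
    (zero_le_one (α := ℝ)) hF01 hF hK ha

/-- Optimizing the free parameter in the influence inequality. -/
lemma mul_log_le_of_forall {V K N : ℝ} (hV : 0 ≤ V) (hV1 : V ≤ 1) (hK : 0 ≤ K) (hN : 1 ≤ N)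
    (H : ∀ a, 0 < a → V * (1 - log a) - N * K ^ 2 / a ≤ 4 * (N * K)) :
    V * log N ≤ 8 * (N * K) := by
  rcases hV.eq_or_lt with rfl | hV
  · simp only [zero_mul]; positivity
  have hN0 : 0 < N := by linarith
  set r := √N with hr
  have hr0 : 0 < r := sqrt_pos.2 hN0
  have hrN : r * r = N := mul_self_sqrt hN0.le
  set s := √r with hs
  have hs0 : 0 < s := sqrt_pos.2 hr0
  have hsr : s * s = r := mul_self_sqrt hr0.le
  have hlogs : log N = 4 * log s := by
    rw [← hrN, ← hsr, log_mul (by positivity) (by positivity), log_mul (by positivity)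
      (by positivity)]
    ring
  have hlogr : log N = 2 * log r := by
    rw [← hrN, log_mul (by positivity) (by positivity)]
    ring
  rcases le_total (V * s) (N * K) with h | h
  · have : log s ≤ s - 1 := log_le_sub_one_of_pos hs0
    rw [hlogs]
    nlinarith
  · have h1 := H (V / r) (by positivity)
    rw [log_div hV.ne' hr0.ne'] at h1
    have h2 : N * K ^ 2 / (V / r) ≤ V := by
      rw [div_le_iff₀ (by positivity), mul_div_assoc', le_div_iff₀ hr0]
      have h3 : (N * K) ^ 2 ≤ (V * s) ^ 2 := by gcongr
      have h4 : N * (N * K ^ 2 * r) ≤ N * (V * V) := by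
        calc N * (N * K ^ 2 * r) = (N * K) ^ 2 * r := by ring
          _ ≤ (V * s) ^ 2 * r := by gcongr
          _ = V * V * ((s * s) * r) := by ring
          _ = N * (V * V) := by rw [hsr, hrN]; ring
      exact le_of_mul_le_mul_left h4 hN0
    have h3 : V * log V ≤ 0 := mul_nonpos_of_nonneg_of_nonpos hV.le (log_nonpos hV.le hV1)
    rw [hlogr]
    nlinarith

theorem variance_mul_log_card_le {ι : Type*} [Fintype ι] [Nonempty ι] {ν : (ι → Bool) → ℝ}
    (hν : ∀ ω, 0 < ν ω) (hν1 : ∑ᶠ ω, ν ω = 1)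
    (hlat : ∀ a b, ν a * ν b ≤ ν (a ⊓ b) * ν (a ⊔ b)) {F : (ι → Bool) → ℝ}
    (hF01 : ∀ ω, F ω = 0 ∨ F ω = 1) (hF : Monotone F) {K : ℝ} (hK0 : 0 ≤ K)
    (hK : ∀ j, (∑ᶠ ω, if ω j = true then ν ω * F ω else 0) /
        (∑ᶠ ω, if ω j = true then ν ω else 0) -
      (∑ᶠ ω, if ω j = true then 0 else ν ω * F ω) /
        (∑ᶠ ω, if ω j = true then 0 else ν ω) ≤ K) :
    (∑ᶠ ω, ν ω * F ω) * (1 - ∑ᶠ ω, ν ω * F ω) * log (Fintype.card ι) ≤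
      8 * (Fintype.card ι * K) := by
  set e : (Fin (Fintype.card ι) → Bool) ≃ (ι → Bool) :=
    Equiv.arrowCongr (Fintype.equivFin ι).symm (Equiv.refl Bool) with he
  have hsum (H : (ι → Bool) → ℝ) : ∑ᶠ ω, H ω = ∑ η, H (e η) := by
    rw [← finsum_comp_equiv e, finsum_eq_sum_of_fintype]
  have hej (η) (j) : e η j = η (Fintype.equivFin ι j) := rfl
  simp only [hsum, hej] at hν1 hK ⊢
  have hmean1 : ∑ η, ν (e η) * F (e η) ≤ 1 := by
    rw [← hν1]
    refine Finset.sum_le_sum fun η _ => ?_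
    have := (hν (e η)).le
    rcases hF01 (e η) with h | h <;> rw [h] <;> linarith
  have hmean0 : 0 ≤ ∑ η, ν (e η) * F (e η) := by
    refine Finset.sum_nonneg fun η _ => ?_
    have := (hν (e η)).le
    rcases hF01 (e η) with h | h <;> rw [h] <;> linarith
  refine mul_log_le_of_forall (mul_nonneg hmean0 (by linarith)) (by nlinarith) hK0
    (by exact_mod_cast Fintype.card_pos) fun a ha => ?_
  refine variance_le_of_lattice (ν := fun η => ν (e η)) (F := fun η => F (e η))
    (fun η => hν _) hν1 (fun a b => hlat (e a) (e b)) (fun η => hF01 _)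
    (fun a b hab => hF fun i => hab _) (fun j => ?_) ha
  have := hK ((Fintype.equivFin ι).symm j)
  simp only [Equiv.apply_symm_apply] at this
  simpa only [Finset.sum_filter, ite_not] using this

section Gibbs

variable {ι : Type*} [Fintype ι]

/-- The probability measure with density proportional to `exp (-E / 2)`. -/
noncomputable def gibbs (E : (ι → ℝ) → ℝ) : Measure (ι → ℝ) :=
  volume.withDensity fun φ => ENNReal.ofReal (exp (-(E φ) / 2) / ∫ ψ, exp (-(E ψ) / 2))

variable {E : (ι → ℝ) → ℝ} {κ : ℝ}

lemma integrable_exp_linear_sub (hE : Continuous E) (hκ : 0 < κ)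
    (hlow : ∀ φ, κ * ∑ x, φ x ^ 2 ≤ E φ) (l : ι → ℝ) :
    Integrable fun φ : ι → ℝ => exp (∑ x, l x * φ x + -(E φ) / 2) := by
  have h1 (a : ℝ) : Integrable fun z : ℝ => exp (a * z - κ * z ^ 2 / 2) := by
    have := ((integrable_exp_neg_mul_sq (half_pos hκ)).comp_sub_right (a / κ)).const_mul
      (exp (a ^ 2 / (2 * κ)))
    refine this.congr (ae_of_all _ fun z => ?_)
    dsimp only
    rw [← exp_add]
    congr 1
    field_simp
    ring
  refine (Integrable.fintype_prod (f := fun x z => exp (l x * z - κ * z ^ 2 / 2))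
    (μ := fun _ => volume) fun x => h1 (l x)).mono' (by fun_prop) (ae_of_all _ fun φ => ?_)
  rw [norm_of_nonneg (exp_nonneg _), ← exp_sum, exp_le_exp, Finset.sum_sub_distrib]
  have := hlow φ
  rw [Finset.mul_sum] at this
  simp only [← Finset.sum_div]
  linarith

lemma integrable_exp_neg (hE : Continuous E) (hκ : 0 < κ)
    (hlow : ∀ φ, κ * ∑ x, φ x ^ 2 ≤ E φ) :
    Integrable fun φ : ι → ℝ => exp (-(E φ) / 2) := by
  simpa using integrable_exp_linear_sub hE hκ hlow 0

lemma partition_pos (hE : Continuous E) (hκ : 0 < κ)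
    (hlow : ∀ φ, κ * ∑ x, φ x ^ 2 ≤ E φ) : 0 < ∫ φ : ι → ℝ, exp (-(E φ) / 2) :=
  integral_exp_pos (integrable_exp_neg hE hκ hlow)

lemma isProbabilityMeasure_gibbs (hE : Continuous E) (hκ : 0 < κ)
    (hlow : ∀ φ, κ * ∑ x, φ x ^ 2 ≤ E φ) : IsProbabilityMeasure (gibbs E) := by
  constructor
  rw [gibbs, withDensity_apply _ MeasurableSet.univ, Measure.restrict_univ,
    ← ofReal_integral_eq_lintegral_ofReal ((integrable_exp_neg hE hκ hlow).div_const _)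
      (ae_of_all _ fun φ => div_nonneg (exp_nonneg _) (integral_nonneg fun _ => exp_nonneg _)),
    integral_div, div_self (partition_pos hE hκ hlow).ne', ENNReal.ofReal_one]

lemma measurable_density (hE : Continuous E) : Measurable fun φ =>
    ENNReal.ofReal (exp (-(E φ) / 2) / ∫ ψ, exp (-(E ψ) / 2)) := by
  have := hE.measurable
  fun_prop

lemma integral_gibbs (hE : Continuous E) (f : (ι → ℝ) → ℝ) :
    ∫ φ, f φ ∂gibbs E = (∫ φ, f φ * exp (-(E φ) / 2)) / ∫ ψ, exp (-(E ψ) / 2) := by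
  rw [gibbs, integral_withDensity_eq_integral_toReal_smul (measurable_density hE)
    (ae_of_all _ fun _ => ENNReal.ofReal_lt_top), ← integral_div]
  congr 1
  ext φ
  rw [ENNReal.toReal_ofReal (div_nonneg (exp_nonneg _) (integral_nonneg fun _ => exp_nonneg _)),
    smul_eq_mul]
  ring

lemma integrable_gibbs (hE : Continuous E) {f : (ι → ℝ) → ℝ}
    (hf : Integrable fun φ => f φ * exp (-(E φ) / 2)) : Integrable f (gibbs E) := by
  rw [gibbs, integrable_withDensity_iff_integrable_smul' (measurable_density hE)
    (ae_of_all _ fun _ => ENNReal.ofReal_lt_top)]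
  refine (hf.div_const (∫ ψ, exp (-(E ψ) / 2))).congr (ae_of_all _ fun φ => ?_)
  dsimp only
  rw [ENNReal.toReal_ofReal (div_nonneg (exp_nonneg _) (integral_nonneg fun _ => exp_nonneg _)),
    smul_eq_mul]
  ring

lemma integrable_exp_linear_gibbs (hE : Continuous E) (hκ : 0 < κ)
    (hlow : ∀ φ, κ * ∑ x, φ x ^ 2 ≤ E φ) (l : ι → ℝ) :
    Integrable (fun φ => exp (∑ x, l x * φ x)) (gibbs E) := by
  refine integrable_gibbs hE ?_
  simpa only [← exp_add] using integrable_exp_linear_sub hE hκ hlow l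

lemma integrableExpSet_linear (hE : Continuous E) (hκ : 0 < κ)
    (hlow : ∀ φ, κ * ∑ x, φ x ^ 2 ≤ E φ) (l : ι → ℝ) :
    ProbabilityTheory.integrableExpSet (fun φ => ∑ x, l x * φ x) (gibbs E) = Set.univ := by
  ext t
  simp only [ProbabilityTheory.integrableExpSet, Set.mem_ofPred_eq, Set.mem_univ, iff_true]
  have := integrable_exp_linear_gibbs hE hκ hlow fun x => t * l x
  simpa only [Finset.mul_sum, mul_assoc] using this

lemma integrableExpSet_coord (hE : Continuous E) (hκ : 0 < κ)
    (hlow : ∀ φ, κ * ∑ x, φ x ^ 2 ≤ E φ) (x : ι) :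
    ProbabilityTheory.integrableExpSet (fun φ => φ x) (gibbs E) = Set.univ := by
  classical
  simpa [Pi.single_apply] using integrableExpSet_linear hE hκ hlow (Pi.single x 1)

lemma integrable_coord (hE : Continuous E) (hκ : 0 < κ)
    (hlow : ∀ φ, κ * ∑ x, φ x ^ 2 ≤ E φ) (x : ι) : Integrable (fun φ => φ x) (gibbs E) :=
  ProbabilityTheory.integrable_of_mem_interior_integrableExpSet
    (by rw [integrableExpSet_coord hE hκ hlow]; simp)

lemma gibbs_pos_of_isOpen (hE : Continuous E) (hκ : 0 < κ)
    (hlow : ∀ φ, κ * ∑ x, φ x ^ 2 ≤ E φ) {U : Set (ι → ℝ)} (hU : IsOpen U) (hne : U.Nonempty) :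
    0 < gibbs E U := by
  rw [pos_iff_ne_zero]
  intro h
  rw [gibbs, withDensity_apply_eq_zero (measurable_density hE)] at h
  have hs : {φ : ι → ℝ | ENNReal.ofReal (exp (-(E φ) / 2) / ∫ ψ, exp (-(E ψ) / 2)) ≠ 0} =
      Set.univ := by
    ext φ
    simp only [Set.mem_ofPred_eq, Set.mem_univ, iff_true, ne_eq, ENNReal.ofReal_eq_zero, not_le]
    exact div_pos (exp_pos _) (partition_pos hE hκ hlow)
  rw [hs, Set.univ_inter] at h
  exact (hU.measure_pos volume hne).ne' h

end Gibbs

section Lattice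

variable {ι : Type*} [Fintype ι] {E : (ι → ℝ) → ℝ} {κ : ℝ}

lemma lintegral_gibbs_four_functions (hE : Continuous E)
    (hlat : ∀ x y, E (x ⊓ y) + E (x ⊔ y) ≤ E x + E y) {f₁ f₂ f₃ f₄ : (ι → ℝ) → ENNReal}
    (h₁ : Measurable f₁) (h₂ : Measurable f₂) (h₃ : Measurable f₃) (h₄ : Measurable f₄)
    (h : ∀ x y, f₁ x * f₂ y ≤ f₃ (x ⊓ y) * f₄ (x ⊔ y)) :
    (∫⁻ x, f₁ x ∂gibbs E) * ∫⁻ x, f₂ x ∂gibbs E ≤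
      (∫⁻ x, f₃ x ∂gibbs E) * ∫⁻ x, f₄ x ∂gibbs E := by
  have hm := measurable_density hE
  simp only [gibbs]
  rw [lintegral_withDensity_eq_lintegral_mul _ hm h₁,
    lintegral_withDensity_eq_lintegral_mul _ hm h₂,
    lintegral_withDensity_eq_lintegral_mul _ hm h₃, lintegral_withDensity_eq_lintegral_mul _ hm h₄]
  refine lintegral_four_functions (hm.mul h₁) (hm.mul h₂) (hm.mul h₃) (hm.mul h₄) fun x y => ?_
  simp only [Pi.mul_apply]
  rw [mul_mul_mul_comm, mul_mul_mul_comm (ENNReal.ofReal _) (f₃ _)]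
  refine mul_le_mul' ?_ (h x y)
  have hZ : 0 ≤ ∫ ψ, exp (-(E ψ) / 2) := integral_nonneg fun _ => exp_nonneg _
  rw [← ENNReal.ofReal_mul (div_nonneg (exp_nonneg _) hZ),
    ← ENNReal.ofReal_mul (div_nonneg (exp_nonneg _) hZ), div_mul_div_comm, div_mul_div_comm,
    ← exp_add, ← exp_add]
  have := hlat x y
  refine ENNReal.ofReal_le_ofReal (div_le_div_of_nonneg_right (exp_le_exp.2 ?_) (mul_nonneg hZ hZ))
  linarith

lemma integral_gibbs_four_functions (hE : Continuous E)
    (hlat : ∀ x y, E (x ⊓ y) + E (x ⊔ y) ≤ E x + E y) {f₁ f₂ f₃ f₄ : (ι → ℝ) → ℝ}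
    (h₁ : Measurable f₁) (h₂ : Measurable f₂) (h₃ : Measurable f₃) (h₄ : Measurable f₄)
    (i₁ : Integrable f₁ (gibbs E)) (i₂ : Integrable f₂ (gibbs E)) (i₃ : Integrable f₃ (gibbs E))
    (i₄ : Integrable f₄ (gibbs E)) (p₁ : ∀ x, 0 ≤ f₁ x) (p₂ : ∀ x, 0 ≤ f₂ x)
    (p₃ : ∀ x, 0 ≤ f₃ x) (p₄ : ∀ x, 0 ≤ f₄ x)
    (h : ∀ x y, f₁ x * f₂ y ≤ f₃ (x ⊓ y) * f₄ (x ⊔ y)) :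
    (∫ x, f₁ x ∂gibbs E) * ∫ x, f₂ x ∂gibbs E ≤
      (∫ x, f₃ x ∂gibbs E) * ∫ x, f₄ x ∂gibbs E := by
  have key := lintegral_gibbs_four_functions hE hlat h₁.ennreal_ofReal h₂.ennreal_ofReal
    h₃.ennreal_ofReal h₄.ennreal_ofReal fun x y => by
      rw [← ENNReal.ofReal_mul (p₁ _), ← ENNReal.ofReal_mul (p₃ _)]
      exact ENNReal.ofReal_le_ofReal (h x y)
  rw [← ofReal_integral_eq_lintegral_ofReal i₁ (ae_of_all _ p₁),
    ← ofReal_integral_eq_lintegral_ofReal i₂ (ae_of_all _ p₂),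
    ← ofReal_integral_eq_lintegral_ofReal i₃ (ae_of_all _ p₃),
    ← ofReal_integral_eq_lintegral_ofReal i₄ (ae_of_all _ p₄),
    ← ENNReal.ofReal_mul (integral_nonneg p₁), ← ENNReal.ofReal_mul (integral_nonneg p₃)] at key
  exact (ENNReal.ofReal_le_ofReal_iff (mul_nonneg (integral_nonneg p₃) (integral_nonneg p₄))).1 key

lemma gibbs_real_mul_le (hE : Continuous E) (hlat : ∀ x y, E (x ⊓ y) + E (x ⊔ y) ≤ E x + E y)
    [IsFiniteMeasure (gibbs E)] {s₁ s₂ s₃ s₄ : Set (ι → ℝ)}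
    (h₁ : MeasurableSet s₁) (h₂ : MeasurableSet s₂) (h₃ : MeasurableSet s₃) (h₄ : MeasurableSet s₄)
    (h : ∀ x ∈ s₁, ∀ y ∈ s₂, x ⊓ y ∈ s₃ ∧ x ⊔ y ∈ s₄) :
    (gibbs E).real s₁ * (gibbs E).real s₂ ≤ (gibbs E).real s₃ * (gibbs E).real s₄ := by
  have hi {s : Set (ι → ℝ)} (hs : MeasurableSet s) :
      Integrable (s.indicator (1 : (ι → ℝ) → ℝ)) (gibbs E) :=
    (integrable_const (1 : ℝ)).indicator hs
  have hp (s : Set (ι → ℝ)) (x) : 0 ≤ s.indicator (1 : (ι → ℝ) → ℝ) x :=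
    Set.indicator_nonneg (fun _ _ => zero_le_one) _
  have hm {s : Set (ι → ℝ)} (hs : MeasurableSet s) : Measurable (s.indicator (1 : (ι → ℝ) → ℝ)) :=
    measurable_one.indicator hs
  have key := integral_gibbs_four_functions hE hlat (hm h₁) (hm h₂) (hm h₃) (hm h₄) (hi h₁) (hi h₂)
    (hi h₃) (hi h₄) (hp _) (hp _) (hp _) (hp _) fun x y => by
      by_cases hx : x ∈ s₁
      · by_cases hy : y ∈ s₂
        · simp [hx, hy, h x hx y hy]
        · simpa [hy] using mul_nonneg (hp _ _) (hp _ _)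
      · simpa [hx] using mul_nonneg (hp _ _) (hp _ _)
  simpa only [integral_indicator_one h₁, integral_indicator_one h₂, integral_indicator_one h₃,
    integral_indicator_one h₄] using key

/-- Comparison of the covariance of an increasing event with a coordinate and the effect of
conditioning this coordinate to be above or below a level. -/
lemma le_setIntegral_coord (hE : Continuous E) (hlat : ∀ x y, E (x ⊓ y) + E (x ⊔ y) ≤ E x + E y)
    [IsProbabilityMeasure (gibbs E)] {B : Set (ι → ℝ)} (hB : IsUpperSet B) (hBm : MeasurableSet B)
    (x : ι) (hint : Integrable (fun φ => φ x) (gibbs E)) (hmean : ∫ φ, φ x ∂gibbs E = 0) (h : ℝ)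
    (hq0 : 0 < (gibbs E).real {φ | h ≤ φ x}) (hq1 : 0 < (gibbs E).real {φ | h ≤ φ x}ᶜ) :
    (∫ φ in {φ | h ≤ φ x}, φ x ∂gibbs E) *
      ((gibbs E).real ({φ | h ≤ φ x} ∩ B) / (gibbs E).real {φ | h ≤ φ x} -
        (gibbs E).real ({φ | h ≤ φ x}ᶜ ∩ B) / (gibbs E).real {φ | h ≤ φ x}ᶜ) ≤
      ∫ φ in B, φ x ∂gibbs E := by
  set μ := gibbs E
  set U : Set (ι → ℝ) := {φ | h ≤ φ x} with hU
  have hUm : MeasurableSet U := measurableSet_le measurable_const (measurable_pi_apply x)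
  have hone {s : Set (ι → ℝ)} (hs : MeasurableSet s) :
      Integrable (s.indicator (1 : (ι → ℝ) → ℝ)) μ := (integrable_const (1 : ℝ)).indicator hs
  have hp (s : Set (ι → ℝ)) (x) : 0 ≤ s.indicator (1 : (ι → ℝ) → ℝ) x :=
    Set.indicator_nonneg (fun _ _ => zero_le_one) _
  have hm {s : Set (ι → ℝ)} (hs : MeasurableSet s) : Measurable (s.indicator (1 : (ι → ℝ) → ℝ)) :=
    measurable_one.indicator hs
  set u : (ι → ℝ) → ℝ := fun φ => max (φ x - h) 0 with hu
  set d : (ι → ℝ) → ℝ := fun φ => max (h - φ x) 0 with hd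
  have hu0 (φ) : 0 ≤ u φ := le_max_right _ _
  have hd0 (φ) : 0 ≤ d φ := le_max_right _ _
  have hum : Measurable u := by fun_prop
  have hdm : Measurable d := by fun_prop
  have hui : Integrable u μ := (hint.sub (integrable_const h)).pos_part
  have hdi : Integrable d μ := ((integrable_const h).sub hint).pos_part
  have hud (φ) : φ x = h + u φ - d φ := by
    simp only [hu, hd]
    rcases le_total (φ x) h with e | e
    · rw [max_eq_right (by linarith), max_eq_left (by linarith)]; ring
    · rw [max_eq_left (by linarith), max_eq_right (by linarith)]; ring
  have key1 := integral_gibbs_four_functions hE hlat (hm (hUm.inter hBm)) hum (hm hUm)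
    (hum.indicator hBm) (hone (hUm.inter hBm)) hui (hone hUm) (hui.indicator hBm) (hp _) hu0 (hp _)
    (fun φ => Set.indicator_nonneg (fun ψ _ => hu0 ψ) _) fun φ ψ => by
      have hr : 0 ≤ U.indicator (1 : (ι → ℝ) → ℝ) (φ ⊓ ψ) * B.indicator u (φ ⊔ ψ) :=
        mul_nonneg (hp _ _) (Set.indicator_nonneg (fun ψ _ => hu0 ψ) _)
      by_cases hφ : φ ∈ U ∩ B
      · by_cases hψ : ψ ∈ U
        · have h1 : φ ⊓ ψ ∈ U := le_inf (show h ≤ φ x from hφ.1) hψ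
          have h2 : φ ⊔ ψ ∈ B := hB le_sup_left hφ.2
          rw [Set.indicator_of_mem hφ, Set.indicator_of_mem h1, Set.indicator_of_mem h2]
          simp only [Pi.one_apply, one_mul, hu]
          exact max_le_max (sub_le_sub_right le_sup_right _) le_rfl
        · have : u ψ = 0 := max_eq_right (sub_nonpos.2 (not_le.1 hψ).le)
          rwa [this, mul_zero]
      · rwa [Set.indicator_of_notMem hφ, zero_mul]
  have key0 := integral_gibbs_four_functions hE hlat (hm (hUm.compl.inter hBm.compl)) hdm
    (hdm.indicator hBm.compl) (hm hUm.compl) (hone (hUm.compl.inter hBm.compl)) hdi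
    (hdi.indicator hBm.compl) (hone hUm.compl) (hp _) hd0
    (fun φ => Set.indicator_nonneg (fun ψ _ => hd0 ψ) _) (hp _) fun φ ψ => by
      have hr : 0 ≤ Bᶜ.indicator d (φ ⊓ ψ) * Uᶜ.indicator (1 : (ι → ℝ) → ℝ) (φ ⊔ ψ) :=
        mul_nonneg (Set.indicator_nonneg (fun ψ _ => hd0 ψ) _) (hp _ _)
      by_cases hφ : φ ∈ Uᶜ ∩ Bᶜ
      · by_cases hψ : ψ ∈ U
        · have : d ψ = 0 := max_eq_right (sub_nonpos.2 hψ)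
          rwa [this, mul_zero]
        · have h1 : φ ⊔ ψ ∈ Uᶜ := by
            have e1 : φ x < h := lt_of_not_ge hφ.1
            have e2 : ψ x < h := lt_of_not_ge hψ
            exact not_le.2 (sup_lt_iff.2 ⟨e1, e2⟩)
          have h2 : φ ⊓ ψ ∈ Bᶜ := fun e => hφ.2 (hB inf_le_left e)
          rw [Set.indicator_of_mem hφ, Set.indicator_of_mem h1, Set.indicator_of_mem h2]
          simp only [Pi.one_apply, one_mul, mul_one, hd]
          exact max_le_max (sub_le_sub_left inf_le_right _) le_rfl
      · rwa [Set.indicator_of_notMem hφ, zero_mul]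
  rw [integral_indicator_one (hUm.inter hBm), integral_indicator_one hUm,
    integral_indicator hBm] at key1
  rw [integral_indicator_one (hUm.compl.inter hBm.compl), integral_indicator_one hUm.compl,
    integral_indicator hBm.compl] at key0
  have hC (s : Set (ι → ℝ)) : ∫ φ in s, φ x ∂μ =
      h * μ.real s + ∫ φ in s, u φ ∂μ - ∫ φ in s, d φ ∂μ := by
    simp only [hud]
    have e1 := integrable_const (μ := μ.restrict s) h
    rw [integral_sub (f := fun φ => h + u φ) (e1.add hui.restrict) hdi.restrict,
      integral_add e1 hui.restrict]
    simp [mul_comm]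
  have hmean' := hC Set.univ
  rw [Measure.restrict_univ, hmean, probReal_univ] at hmean'
  have hUu : ∫ φ in U, u φ ∂μ = ∫ φ, u φ ∂μ :=
    setIntegral_eq_integral_of_forall_compl_eq_zero fun φ hφ =>
      max_eq_right (sub_nonpos.2 (lt_of_not_ge hφ).le)
  have hUd : ∫ φ in U, d φ ∂μ = 0 :=
    setIntegral_eq_zero_of_forall_eq_zero fun φ hφ => max_eq_right (sub_nonpos.2 hφ)
  have hBd := integral_add_compl hBm hdi
  have hUc := probReal_add_probReal_compl (μ := μ) hUm
  have hsplit := measureReal_inter_add_sdiff (μ := μ) (s := B) hUm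
  have hsplit' := measureReal_inter_add_sdiff (μ := μ) (s := Uᶜ) hBm
  rw [Set.sdiff_eq] at hsplit hsplit'
  rw [Set.inter_comm B U, Set.inter_comm B Uᶜ] at hsplit
  rw [hC U, hC B, hUu, hUd, ← hsplit]
  rw [← eq_sub_iff_add_eq'] at hsplit'
  rw [hsplit'] at key0
  set q := μ.real U
  set r := μ.real Uᶜ
  set b₁ := μ.real (U ∩ B)
  set b₀ := μ.real (Uᶜ ∩ B)
  have k1 : b₁ * (∫ φ, u φ ∂μ) / q ≤ ∫ φ in B, u φ ∂μ := by
    rw [div_le_iff₀ hq0, mul_comm (∫ φ in B, u φ ∂μ)]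
    exact key1
  have k0 : (r - b₀) * (∫ φ, d φ ∂μ) / r ≤ ∫ φ in Bᶜ, d φ ∂μ := by
    rwa [div_le_iff₀ hq1]
  have e1 : b₁ * (∫ φ, u φ ∂μ) / q = (∫ φ, u φ ∂μ) * (b₁ / q) := by ring
  have e0 : (r - b₀) * (∫ φ, d φ ∂μ) / r = (∫ φ, d φ ∂μ) - (∫ φ, d φ ∂μ) * (b₀ / r) := by
    field_simp
  have e2 : h * b₁ = h * q * (b₁ / q) := by field_simp
  have e3 : h * b₀ = h * r * (b₀ / r) := by field_simp
  have e4 : h * q + ∫ φ, u φ ∂μ = (∫ φ, d φ ∂μ) - h * r := by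
    rw [show r = 1 - q by linarith]
    linarith
  have e5 : (h * q + ∫ φ, u φ ∂μ) * (b₀ / r) = (∫ φ, d φ ∂μ) * (b₀ / r) - h * r * (b₀ / r) := by
    rw [e4]; ring
  rw [sub_zero, mul_sub, e5, add_mul, mul_add, e2, e3]
  linarith

lemma inter_compl_mul_le (hE : Continuous E) (hlat : ∀ x y, E (x ⊓ y) + E (x ⊔ y) ≤ E x + E y)
    [IsProbabilityMeasure (gibbs E)] {B : Set (ι → ℝ)} (hB : IsUpperSet B) (hBm : MeasurableSet B)
    (x : ι) (h : ℝ) :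
    (gibbs E).real ({φ | h ≤ φ x}ᶜ ∩ B) * (gibbs E).real {φ | h ≤ φ x} ≤
      (gibbs E).real {φ | h ≤ φ x}ᶜ * (gibbs E).real ({φ | h ≤ φ x} ∩ B) := by
  have hUm : MeasurableSet {φ : ι → ℝ | h ≤ φ x} :=
    measurableSet_le measurable_const (measurable_pi_apply x)
  refine gibbs_real_mul_le hE hlat (hUm.compl.inter hBm) hUm hUm.compl (hUm.inter hBm) ?_
  intro φ hφ ψ hψ
  exact ⟨fun e => hφ.1 (le_trans (show h ≤ φ x ⊓ ψ x from e) inf_le_left),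
    show h ≤ φ x ⊔ ψ x from le_trans hψ le_sup_right, hB le_sup_left hφ.2⟩

end Lattice

section LevelSets

variable {G : Type}

lemma isUpperSet_levSet {A : Set (G → Bool)} (hA : IsUpperSet A) (h : ℝ) :
    IsUpperSet (levSet A h) := by
  intro φ ψ hφψ hφ
  refine hA (fun x => ?_) hφ
  rw [Bool.le_iff_imp]
  simpa using fun e : h ≤ φ x => e.trans (hφψ x)

variable [Fintype G]

lemma measurableSet_levSet (A : Set (G → Bool)) (h : ℝ) : MeasurableSet (levSet A h) := by
  have : Measurable fun (φ : G → ℝ) x => decide (h ≤ φ x) := by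
    refine measurable_pi_iff.2 fun x => measurable_to_bool ?_
    convert! measurableSet_le (measurable_const (a := h))
      (measurable_pi_apply (X := fun _ : G => ℝ) x) using 1
    ext φ
    simp
  exact this (Set.toFinite A).measurableSet

lemma finsum_levSet_singleton (μ : Measure (G → ℝ)) [IsFiniteMeasure μ] (h : ℝ)
    (P : (G → Bool) → Prop) [DecidablePred P] :
    ∑ᶠ ω, (if P ω then μ.real (levSet {ω} h) else 0) = μ.real (levSet {ω | P ω} h) := by
  classical
  rw [finsum_eq_sum_of_fintype, ← Finset.sum_filter]
  convert! sum_measureReal_preimage_singleton (μ := μ) (Finset.univ.filter P)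
    (f := fun (φ : G → ℝ) x => decide (h ≤ φ x)) (fun ω _ => measurableSet_levSet {ω} h) using 2
  ext φ
  simp [levSet]

variable {E : (G → ℝ) → ℝ} {κ : ℝ}

lemma gibbs_real_levSet_singleton_pos (hE : Continuous E) (hκ : 0 < κ)
    (hlow : ∀ φ, κ * ∑ x, φ x ^ 2 ≤ E φ) (ω : G → Bool) (h : ℝ) :
    0 < (gibbs E).real (levSet {ω} h) := by
  have := isProbabilityMeasure_gibbs hE hκ hlow
  refine ENNReal.toReal_pos ?_ (measure_ne_top _ _)
  have hU : IsOpen (Set.univ.pi fun x => if ω x = true then Set.Ioi h else Set.Iio h) :=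
    isOpen_set_pi Set.finite_univ fun x _ => by
      split_ifs
      · exact isOpen_Ioi
      · exact isOpen_Iio
  have hpos := gibbs_pos_of_isOpen hE hκ hlow hU
    ⟨fun x => if ω x = true then h + 1 else h - 1, fun x _ => by
      dsimp only
      split_ifs
      · exact lt_add_one h
      · exact sub_one_lt h⟩
  refine (hpos.trans_le (measure_mono fun φ hφ => ?_)).ne'
  funext x
  have := hφ x trivial
  dsimp only at this
  split_ifs at this with e
  · rw [e]
    exact decide_eq_true (le_of_lt this)
  · rw [Bool.not_eq_true] at e
    rw [e]
    exact decide_eq_false (not_le.2 this)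

/-- A lower bound on the total covariance of an increasing level-set event with the field. -/
theorem levSet_variance_mul_log_le [Nonempty G] (hE : Continuous E) (hκ : 0 < κ)
    (hlow : ∀ φ, κ * ∑ x, φ x ^ 2 ≤ E φ) (hlat : ∀ x y, E (x ⊓ y) + E (x ⊔ y) ≤ E x + E y)
    (hmean : ∀ x, ∫ φ, φ x ∂gibbs E = 0) {A : Set (G → Bool)} (hA : IsUpperSet A) {h m C : ℝ}
    (hm0 : 0 < m) (hm : ∀ x, m ≤ ∫ φ in {φ | h ≤ φ x}, φ x ∂gibbs E)
    (hC : ∀ x, ∫ φ in levSet A h, φ x ∂gibbs E ≤ C) :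
    m * ((gibbs E).real (levSet A h) * (1 - (gibbs E).real (levSet A h)) *
      log (Fintype.card G)) ≤ 8 * (Fintype.card G * C) := by
  classical
  have := isProbabilityMeasure_gibbs hE hκ hlow
  set μ := gibbs E
  set B := levSet A h with hBdef
  have hB : IsUpperSet B := isUpperSet_levSet hA h
  have hBm : MeasurableSet B := measurableSet_levSet A h
  have hUm (x : G) : MeasurableSet {φ : G → ℝ | h ≤ φ x} :=
    measurableSet_le measurable_const (measurable_pi_apply x)
  have hcell (ω : G → Bool) : 0 < μ.real (levSet {ω} h) :=
    gibbs_real_levSet_singleton_pos hE hκ hlow ω h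
  have hq0 (x : G) : 0 < μ.real {φ | h ≤ φ x} :=
    (hcell fun _ => true).trans_le (measureReal_mono fun φ hφ => by
      simpa using congrFun (show _ = _ from hφ) x)
  have hq1 (x : G) : 0 < μ.real {φ | h ≤ φ x}ᶜ :=
    (hcell fun _ => false).trans_le (measureReal_mono fun φ hφ => by
      simpa using congrFun (show _ = _ from hφ) x)
  have hdiff (x : G) : 0 ≤ μ.real ({φ | h ≤ φ x} ∩ B) / μ.real {φ | h ≤ φ x} -
      μ.real ({φ | h ≤ φ x}ᶜ ∩ B) / μ.real {φ | h ≤ φ x}ᶜ := by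
    rw [sub_nonneg, div_le_div_iff₀ (hq1 x) (hq0 x)]
    have := inter_compl_mul_le hE hlat hB hBm x h
    linarith
  have hJ (x : G) : μ.real ({φ | h ≤ φ x} ∩ B) / μ.real {φ | h ≤ φ x} -
      μ.real ({φ | h ≤ φ x}ᶜ ∩ B) / μ.real {φ | h ≤ φ x}ᶜ ≤ C / m := by
    rw [le_div_iff₀ hm0, mul_comm]
    refine (mul_le_mul_of_nonneg_right (hm x) (hdiff x)).trans
      ((le_setIntegral_coord hE hlat hB hBm x (integrable_coord hE hκ hlow x) (hmean x) h
        (hq0 x) (hq1 x)).trans (hC x))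
  have hK0 : 0 ≤ C / m := (hdiff (Classical.arbitrary G)).trans (hJ _)
  have hsum (P : (G → Bool) → Prop) [DecidablePred P] := finsum_levSet_singleton μ h P
  have hF : ∑ᶠ ω, μ.real (levSet {ω} h) * (if ω ∈ A then 1 else 0) = μ.real B := by
    simpa using hsum (· ∈ A)
  have key := variance_mul_log_card_le (ν := fun ω => μ.real (levSet {ω} h))
    (F := fun ω => if ω ∈ A then 1 else 0) hcell ?_ ?_ ?_ ?_ hK0 ?_
  · rw [hF] at key
    calc _ ≤ m * (8 * (Fintype.card G * (C / m))) := mul_le_mul_of_nonneg_left key hm0.le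
      _ = _ := by field_simp
  · have := hsum fun _ => True
    simpa [levSet] using this
  · intro a b
    refine gibbs_real_mul_le hE hlat (measurableSet_levSet _ _) (measurableSet_levSet _ _)
      (measurableSet_levSet _ _) (measurableSet_levSet _ _) fun φ hφ ψ hψ => ?_
    have hφ : (fun x => decide (h ≤ φ x)) = a := hφ
    have hψ : (fun x => decide (h ≤ ψ x)) = b := hψ
    subst hφ hψ
    constructor
    · change (fun x => decide (h ≤ φ x ⊓ ψ x)) = _
      ext x
      simp
    · change (fun x => decide (h ≤ φ x ⊔ ψ x)) = _
      ext x
      simp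
  · intro ω
    split_ifs <;> simp
  · intro a b hab
    dsimp only
    by_cases ha : a ∈ A
    · rw [if_pos ha, if_pos (hA hab ha)]
    · rw [if_neg ha]
      split_ifs <;> norm_num
  · intro x
    have e1 := hsum fun ω => ω x = true ∧ ω ∈ A
    have e2 := hsum fun ω => ω x = true
    have e3 := hsum fun ω => ¬ ω x = true ∧ ω ∈ A
    have e4 := hsum fun ω => ¬ ω x = true
    have s1 : levSet {ω : G → Bool | ω x = true ∧ ω ∈ A} h = {φ | h ≤ φ x} ∩ B := by
      ext φ; simp [levSet, hBdef]
    have s2 : levSet {ω : G → Bool | ω x = true} h = {φ | h ≤ φ x} := by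
      ext φ; simp [levSet]
    have s3 : levSet {ω : G → Bool | ¬ ω x = true ∧ ω ∈ A} h = {φ | h ≤ φ x}ᶜ ∩ B := by
      ext φ; simp [levSet, hBdef]
    have s4 : levSet {ω : G → Bool | ¬ ω x = true} h = {φ | h ≤ φ x}ᶜ := by
      ext φ; simp [levSet]
    rw [s1] at e1
    rw [s2] at e2
    rw [s3] at e3
    rw [s4] at e4
    refine le_trans (le_of_eq ?_) (hJ x)
    rw [← e1, ← e2, ← e3, ← e4]
    simp only [ite_and, ite_not, mul_ite, mul_one, mul_zero]

end LevelSets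

section Marginal

open ProbabilityTheory
open scoped NNReal

lemma setIntegral_Ici_gaussianReal {v : ℝ≥0} (hv : v ≠ 0) (h : ℝ) :
    ∫ z in Set.Ici h, z ∂gaussianReal 0 v = v * gaussianPDFReal 0 v h := by
  have hv' : (0 : ℝ) < v := by exact_mod_cast pos_iff_ne_zero.2 hv
  rw [← integral_indicator measurableSet_Ici, integral_gaussianReal_eq_integral_smul hv]
  have e (z : ℝ) : gaussianPDFReal 0 v z • (Set.Ici h).indicator (fun z => z) z =
      (Set.Ici h).indicator (fun z => gaussianPDFReal 0 v z * z) z := by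
    by_cases hz : z ∈ Set.Ici h <;> simp [hz]
  simp_rw [e]
  rw [integral_indicator measurableSet_Ici, integral_Ici_eq_integral_Ioi]
  have hderiv (z : ℝ) :
      HasDerivAt (fun z => -(v * gaussianPDFReal 0 v z)) (gaussianPDFReal 0 v z * z) z := by
    simp only [gaussianPDFReal, sub_zero]
    have h1 : HasDerivAt (fun z : ℝ => -z ^ 2 / (2 * v)) (-(2 * z) / (2 * v)) z := by
      simpa using ((hasDerivAt_pow 2 z).neg).div_const (2 * (v : ℝ))
    convert! ((h1.exp.const_mul (√(2 * π * v))⁻¹).const_mul (v : ℝ)).neg using 1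
    field_simp
  have hint : Integrable fun z => gaussianPDFReal 0 v z * z := by
    have := (integrable_mul_exp_neg_mul_sq (b := (2 * (v : ℝ))⁻¹) (by positivity)).const_mul
      (√(2 * π * v))⁻¹
    refine this.congr (ae_of_all _ fun z => ?_)
    simp only [gaussianPDFReal, sub_zero]
    rw [show -z ^ 2 / (2 * (v : ℝ)) = -(2 * (v : ℝ))⁻¹ * z ^ 2 by ring]
    ring
  have hlim : Filter.Tendsto (fun z => -((v : ℝ) * gaussianPDFReal 0 v z)) Filter.atTop
      (nhds 0) := by
    have h1 : Filter.Tendsto (fun z : ℝ => -z ^ 2 / (2 * (v : ℝ))) Filter.atTop Filter.atBot := by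
      refine Filter.Tendsto.atBot_div_const (by positivity) ?_
      exact Filter.tendsto_neg_atTop_atBot.comp (Filter.tendsto_pow_atTop two_ne_zero)
    have := (((tendsto_exp_atBot.comp h1).const_mul (√(2 * π * v))⁻¹).const_mul (v : ℝ)).neg
    simpa [gaussianPDFReal, Function.comp_def] using this
  rw [integral_Ioi_of_hasDerivAt_of_tendsto' (fun z _ => hderiv z) hint.integrableOn hlim]
  ring

lemma le_setIntegral_Ici_gaussianReal {v : ℝ≥0} {v₀ h M : ℝ} (hv₀ : 0 < v₀) (hv : v₀ ≤ v)
    (hh : |h| ≤ M) :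
    √v₀ / √(2 * π) * exp (-M ^ 2 / (2 * v₀)) ≤ ∫ z in Set.Ici h, z ∂gaussianReal 0 v := by
  have hv' : (0 : ℝ) < v := hv₀.trans_le hv
  rw [setIntegral_Ici_gaussianReal (by exact_mod_cast hv'.ne'), gaussianPDFReal,
    Real.sqrt_mul (show (0 : ℝ) ≤ 2 * π by positivity) (v : ℝ), sub_zero]
  have hs : (v : ℝ) * (√(2 * π) * √v)⁻¹ = √v / √(2 * π) := by
    have : √(v : ℝ) ≠ 0 := (sqrt_pos.2 hv').ne'
    field_simp
    exact (sq_sqrt hv'.le).symm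
  rw [← mul_assoc, hs]
  have h1 : h ^ 2 ≤ M ^ 2 := sq_le_sq' (by linarith [neg_abs_le h]) ((le_abs_self h).trans hh)
  have h2 : h ^ 2 / (2 * v) ≤ M ^ 2 / (2 * v₀) := by gcongr
  rw [neg_div, neg_div]
  gcongr

variable {ι : Type*} [Fintype ι] {E : (ι → ℝ) → ℝ} {κ : ℝ}

lemma exists_represents_coord {B : LinearMap.BilinForm ℝ (ι → ℝ)} (hB : ∀ φ, E φ = B φ φ)
    (hκ : 0 < κ) (hlow : ∀ φ, κ * ∑ x, φ x ^ 2 ≤ E φ) (x : ι) : ∃ u, ∀ φ, B u φ = φ x := by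
  have hinj : Function.Injective B := by
    rw [injective_iff_map_eq_zero]
    intro φ hφ
    have h0 : E φ = 0 := by rw [hB, hφ]; rfl
    have h1 := hlow φ
    rw [h0] at h1
    have h2 : ∑ x, φ x ^ 2 ≤ 0 := by
      by_contra! h
      exact absurd (mul_pos hκ h) (not_lt.2 h1)
    have h3 := (Finset.sum_eq_zero_iff_of_nonneg fun y _ => sq_nonneg (φ y)).1
      (le_antisymm h2 (Finset.sum_nonneg fun y _ => sq_nonneg _))
    ext y
    exact pow_eq_zero_iff two_ne_zero |>.1 (h3 y (Finset.mem_univ y))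
  have hsurj := (LinearMap.injective_iff_surjective_of_finrank_eq_finrank
    (Subspace.dual_finrank_eq (K := ℝ) (V := ι → ℝ)).symm).1 hinj
  obtain ⟨u, hu⟩ := hsurj (LinearMap.proj x)
  exact ⟨u, fun φ => by rw [hu]; rfl⟩

/-- The coordinates of a Gaussian Gibbs measure are centered Gaussian random variables. -/
lemma exists_map_coord_gibbs (hE : Continuous E) {B : LinearMap.BilinForm ℝ (ι → ℝ)}
    (hB : ∀ φ, E φ = B φ φ) (hsymm : ∀ φ ψ, B φ ψ = B ψ φ) (hκ : 0 < κ)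
    (hlow : ∀ φ, κ * ∑ x, φ x ^ 2 ≤ E φ) (x : ι) :
    ∃ v : ℝ≥0, (gibbs E).map (fun φ => φ x) = gaussianReal 0 v := by
  have := isProbabilityMeasure_gibbs hE hκ hlow
  obtain ⟨u, hu⟩ := exists_represents_coord hB hκ hlow x
  have hEu : 0 ≤ E u := (mul_nonneg hκ.le (Finset.sum_nonneg fun y _ => sq_nonneg _)).trans (hlow u)
  refine ⟨(E u).toNNReal, ?_⟩
  have hmgf : mgf (fun φ => φ x) (gibbs E) = mgf id (gaussianReal 0 (E u).toNNReal) := by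
    rw [mgf_id_gaussianReal]
    ext t
    rw [mgf, integral_gibbs hE]
    have e (φ : ι → ℝ) : exp (t * φ x) * exp (-(E φ) / 2) =
        exp (0 * t + E u * t ^ 2 / 2) * exp (-(E (φ - t • u)) / 2) := by
      rw [← exp_add, ← exp_add, hB (φ - t • u), hB φ, hB u]
      congr 1
      simp only [map_sub, LinearMap.sub_apply, map_smul, LinearMap.smul_apply, smul_eq_mul,
        hsymm φ u, hu]
      ring
    simp_rw [e]
    rw [integral_const_mul, integral_sub_right_eq_self fun φ => exp (-(E φ) / 2), mul_div_assoc,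
      div_self (partition_pos hE hκ hlow).ne', mul_one,
      Real.coe_toNNReal _ hEu]
  have hc : complexMGF (fun φ => φ x) (gibbs E) =
      complexMGF id (gaussianReal 0 (E u).toNNReal) := by
    ext z
    refine eqOn_complexMGF_of_mgf hmgf ?_
    rw [integrableExpSet_coord hE hκ hlow]
    simp
  have := Measure.ext_of_complexMGF_eq (measurable_pi_apply x).aemeasurable aemeasurable_id hc
  rwa [Measure.map_id] at this

lemma integral_coord_gibbs_eq_zero (hE : Continuous E) {B : LinearMap.BilinForm ℝ (ι → ℝ)}
    (hB : ∀ φ, E φ = B φ φ) (hsymm : ∀ φ ψ, B φ ψ = B ψ φ) (hκ : 0 < κ)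
    (hlow : ∀ φ, κ * ∑ x, φ x ^ 2 ≤ E φ) (x : ι) : ∫ φ, φ x ∂gibbs E = 0 := by
  obtain ⟨v, hv⟩ := exists_map_coord_gibbs hE hB hsymm hκ hlow x
  have h1 := integral_id_gaussianReal (μ := 0) (v := v)
  rwa [← hv, integral_map (measurable_pi_apply x).aemeasurable (by fun_prop)] at h1

lemma le_setIntegral_coord_ge (hE : Continuous E) {B : LinearMap.BilinForm ℝ (ι → ℝ)}
    (hB : ∀ φ, E φ = B φ φ) (hsymm : ∀ φ ψ, B φ ψ = B ψ φ) (hκ : 0 < κ)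
    (hlow : ∀ φ, κ * ∑ x, φ x ^ 2 ≤ E φ) (x : ι) {v₀ h M : ℝ} (hv₀ : 0 < v₀)
    (hx : v₀ ≤ ∫ φ, φ x ^ 2 ∂gibbs E) (hh : |h| ≤ M) :
    √v₀ / √(2 * π) * exp (-M ^ 2 / (2 * v₀)) ≤ ∫ φ in {φ | h ≤ φ x}, φ x ∂gibbs E := by
  obtain ⟨v, hv⟩ := exists_map_coord_gibbs hE hB hsymm hκ hlow x
  have hm := measurable_pi_apply (X := fun _ : ι => ℝ) x
  have h2 := variance_fun_id_gaussianReal (μ := 0) (v := v)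
  rw [variance_of_integral_eq_zero (by fun_prop) integral_id_gaussianReal, ← hv,
    integral_map hm.aemeasurable (by fun_prop)] at h2
  rw [h2] at hx
  refine (le_setIntegral_Ici_gaussianReal hv₀ hx hh).trans (le_of_eq ?_)
  rw [← hv, setIntegral_map measurableSet_Ici (by fun_prop) hm.aemeasurable]
  rfl

end Marginal

section Energy

variable {G : Type} [Fintype G]

/-- The energy of a massive Gaussian free field with conductances `c` and mass `κ`. -/
noncomputable def energy (c : G → G → ℝ) (κ : ℝ) (φ : G → ℝ) : ℝ :=
  (1 / 2) * ∑ x, ∑ y, c x y * (φ y - φ x) ^ 2 + κ * ∑ x, φ x ^ 2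

/-- The polarization of `energy`. -/
noncomputable def energyForm (c : G → G → ℝ) (κ : ℝ) : LinearMap.BilinForm ℝ (G → ℝ) :=
  LinearMap.mk₂ ℝ (fun φ ψ => (1 / 2) * ∑ x, ∑ y, c x y * ((φ y - φ x) * (ψ y - ψ x)) +
      κ * ∑ x, φ x * ψ x)
    (fun φ φ' ψ => by
      simp only [Pi.add_apply, add_mul, mul_add, add_sub_add_comm, Finset.sum_add_distrib]
      ring)
    (fun a φ ψ => by
      simp only [Pi.smul_apply, smul_eq_mul, ← mul_sub, Finset.mul_sum, mul_add]
      congr 1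
      · exact Finset.sum_congr rfl fun x _ => Finset.sum_congr rfl fun y _ => by ring
      · exact Finset.sum_congr rfl fun x _ => by ring)
    (fun φ ψ ψ' => by
      simp only [Pi.add_apply, mul_add, add_sub_add_comm, Finset.sum_add_distrib]
      ring)
    (fun a φ ψ => by
      simp only [Pi.smul_apply, smul_eq_mul, ← mul_sub, Finset.mul_sum, mul_add]
      congr 1
      · exact Finset.sum_congr rfl fun x _ => Finset.sum_congr rfl fun y _ => by ring
      · exact Finset.sum_congr rfl fun x _ => by ring)

variable (c : G → G → ℝ) (κ : ℝ)

lemma energy_eq_energyForm (φ : G → ℝ) : energy c κ φ = energyForm c κ φ φ := by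
  simp only [energy, energyForm, LinearMap.mk₂_apply, sq]

lemma energyForm_comm (φ ψ : G → ℝ) : energyForm c κ φ ψ = energyForm c κ ψ φ := by
  simp only [energyForm, LinearMap.mk₂_apply, mul_comm (φ _ - φ _), mul_comm (φ _)]

lemma continuous_energy : Continuous (energy c κ) := by
  unfold energy
  fun_prop

lemma energy_add_const (φ : G → ℝ) (t : ℝ) :
    energy c κ (fun x => φ x + t) =
      energy c κ φ + 2 * κ * t * ∑ x, φ x + κ * Fintype.card G * t ^ 2 := by
  have e : ∑ x, (φ x + t) ^ 2 = ∑ x, φ x ^ 2 + 2 * t * ∑ x, φ x + Fintype.card G * t ^ 2 := by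
    simp only [add_sq, Finset.sum_add_distrib, Finset.sum_const, Finset.card_univ, nsmul_eq_mul,
      Finset.mul_sum]
    congr 2
    exact Finset.sum_congr rfl fun x _ => by ring
  simp only [energy, e, add_sub_add_right_eq_sub]
  ring

variable {c κ}

lemma mul_sum_sq_le_energy (hc : ∀ x y, 0 ≤ c x y) (φ : G → ℝ) :
    κ * ∑ x, φ x ^ 2 ≤ energy c κ φ :=
  le_add_of_nonneg_left <| mul_nonneg (by norm_num) <| Finset.sum_nonneg fun x _ =>
    Finset.sum_nonneg fun y _ => mul_nonneg (hc x y) (sq_nonneg _)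

lemma energy_inf_add_energy_sup_le (hc : ∀ x y, 0 ≤ c x y) (φ ψ : G → ℝ) :
    energy c κ (φ ⊓ ψ) + energy c κ (φ ⊔ ψ) ≤ energy c κ φ + energy c κ ψ := by
  have hd (a b : ℝ) : (a ⊓ b) ^ 2 + (a ⊔ b) ^ 2 = a ^ 2 + b ^ 2 := by
    rcases le_total a b with h | h <;> simp [h, add_comm]
  have hp (a b a' b' : ℝ) :
      (a' ⊓ b' - a ⊓ b) ^ 2 + (a' ⊔ b' - a ⊔ b) ^ 2 ≤ (a' - a) ^ 2 + (b' - b) ^ 2 := by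
    rcases le_total a b with h | h <;> rcases le_total a' b' with h' | h' <;>
      simp only [h, h', inf_of_le_left, inf_of_le_right, sup_of_le_left, sup_of_le_right] <;>
      nlinarith [mul_nonneg (sub_nonneg.2 h) (sub_nonneg.2 h')]
  have h1 : ∑ x, (φ ⊓ ψ) x ^ 2 + ∑ x, (φ ⊔ ψ) x ^ 2 = ∑ x, φ x ^ 2 + ∑ x, ψ x ^ 2 := by
    simp only [← Finset.sum_add_distrib, Pi.inf_apply, Pi.sup_apply, hd]
  have h2 : ∑ x, ∑ y, c x y * ((φ ⊓ ψ) y - (φ ⊓ ψ) x) ^ 2 +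
      ∑ x, ∑ y, c x y * ((φ ⊔ ψ) y - (φ ⊔ ψ) x) ^ 2 ≤
      ∑ x, ∑ y, c x y * (φ y - φ x) ^ 2 + ∑ x, ∑ y, c x y * (ψ y - ψ x) ^ 2 := by
    simp only [← Finset.sum_add_distrib, ← mul_add]
    exact Finset.sum_le_sum fun x _ => Finset.sum_le_sum fun y _ =>
      mul_le_mul_of_nonneg_left (hp _ _ _ _) (hc x y)
  simp only [energy]
  linear_combination (1 / 2) * h2 + κ * h1

variable (c κ) in
lemma energy_comp_equiv (e : G ≃ G) (he : ∀ x y, c (e x) (e y) = c x y) (φ : G → ℝ) :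
    energy c κ (φ ∘ e) = energy c κ φ := by
  simp only [energy, Function.comp_apply]
  rw [Equiv.sum_comp e fun x => φ x ^ 2]
  congr 2
  calc ∑ x, ∑ y, c x y * (φ (e y) - φ (e x)) ^ 2
      = ∑ x, ∑ y, c (e x) (e y) * (φ (e y) - φ (e x)) ^ 2 := by simp only [he]
    _ = ∑ x, ∑ y, c (e x) y * (φ y - φ (e x)) ^ 2 :=
        Finset.sum_congr rfl fun x _ => Equiv.sum_comp e fun y => c (e x) y * (φ y - φ (e x)) ^ 2
    _ = _ := Equiv.sum_comp e fun x => ∑ y, c x y * (φ y - φ x) ^ 2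

/-- The law is invariant under permutations of the sites which preserve the energy. -/
lemma setIntegral_gibbs_comp_equiv {E : (G → ℝ) → ℝ} (hE : Continuous E) (e : G ≃ G)
    (he : ∀ φ, E (φ ∘ e) = E φ) {B : Set (G → ℝ)} (hBm : MeasurableSet B)
    (hB : ∀ φ, φ ∘ e ∈ B ↔ φ ∈ B) (x : G) :
    ∫ φ in B, φ (e x) ∂gibbs E = ∫ φ in B, φ x ∂gibbs E := by
  have hmp : MeasurePreserving (fun φ : G → ℝ => φ ∘ e) :=
    (volume_measurePreserving_piCongrLeft (fun _ : G => ℝ) e).symm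
  have hemb : MeasurableEmbedding (fun φ : G → ℝ => φ ∘ e) :=
    (MeasurableEquiv.piCongrLeft (fun _ : G => ℝ) e).symm.measurableEmbedding
  rw [← integral_indicator hBm, ← integral_indicator hBm, integral_gibbs hE, integral_gibbs hE]
  congr 1
  rw [eq_comm, ← hmp.integral_comp hemb]
  congr 1
  ext φ
  by_cases hφ : φ ∈ B
  · rw [he, Set.indicator_of_mem hφ, Set.indicator_of_mem ((hB φ).2 hφ)]
    rfl
  · rw [he, Set.indicator_of_notMem hφ, Set.indicator_of_notMem (mt (hB φ).1 hφ)]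

lemma hasDerivAt_gibbs_levSet {A : Set (G → Bool)} (hκ : 0 < κ) (hc : ∀ x y, 0 ≤ c x y) (h : ℝ) :
    HasDerivAt (fun h => (gibbs (energy c κ)).real (levSet A h))
      (-(κ * ∑ x, ∫ φ in levSet A h, φ x ∂gibbs (energy c κ))) h := by
  have hE := continuous_energy c κ
  have hlow := mul_sum_sq_le_energy (κ := κ) hc
  have := isProbabilityMeasure_gibbs hE hκ hlow
  have hmem (t : ℝ) (φ : G → ℝ) :
      (fun x => φ x + t) ∈ levSet A (h + t) ↔ φ ∈ levSet A h := by
    simp only [levSet, Set.mem_ofPred_eq, add_le_add_iff_right]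
  have key (t : ℝ) : (gibbs (energy c κ)).real (levSet A (h + t)) =
      exp (-(κ * Fintype.card G * t ^ 2) / 2) *
        ProbabilityTheory.mgf (fun φ => ∑ x, φ x)
          ((gibbs (energy c κ)).restrict (levSet A h)) (-κ * t) := by
    rw [ProbabilityTheory.mgf, ← integral_indicator (measurableSet_levSet A h),
      ← integral_indicator_one (measurableSet_levSet A (h + t)), integral_gibbs hE,
      integral_gibbs hE, ← mul_div_assoc, ← integral_const_mul,
      ← integral_add_right_eq_self _ (fun _ => t)]
    congr 2
    ext φ
    have e := energy_add_const c κ φ t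
    change (levSet A (h + t)).indicator 1 (fun x => φ x + t) *
      exp (-(energy c κ (fun x => φ x + t)) / 2) = _
    rw [e]
    by_cases hφ : φ ∈ levSet A h
    · rw [Set.indicator_of_mem ((hmem t φ).2 hφ), Set.indicator_of_mem hφ, Pi.one_apply,
        one_mul, ← exp_add, ← exp_add]
      congr 1
      ring
    · rw [Set.indicator_of_notMem (mt (hmem t φ).1 hφ), Set.indicator_of_notMem hφ]
      simp
  have hexp : ProbabilityTheory.integrableExpSet (fun φ : G → ℝ => ∑ x, φ x)
      ((gibbs (energy c κ)).restrict (levSet A h)) = Set.univ := by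
    refine Set.eq_univ_of_forall fun t => ?_
    have h1 : t ∈ ProbabilityTheory.integrableExpSet (fun φ : G → ℝ => ∑ x, 1 * φ x)
        (gibbs (energy c κ)) := by
      have := integrableExpSet_linear hE hκ hlow fun _ : G => (1 : ℝ)
      rw [this]
      trivial
    simp only [one_mul] at h1
    exact Integrable.restrict h1
  have hmgf := ProbabilityTheory.hasDerivAt_mgf (X := fun φ : G → ℝ => ∑ x, φ x)
    (μ := (gibbs (energy c κ)).restrict (levSet A h)) (t := -κ * (h - h)) (by simp [hexp])
  have hlin : HasDerivAt (fun s : ℝ => -κ * (s - h)) (-κ) h := by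
    simpa using ((hasDerivAt_id h).sub_const h).const_mul (-κ)
  have hgau : HasDerivAt (fun s : ℝ => exp (-(κ * Fintype.card G * (s - h) ^ 2) / 2)) 0 h := by
    have h1 : HasDerivAt (fun s : ℝ => -(κ * Fintype.card G * (s - h) ^ 2) / 2) 0 h := by
      simpa using (((((hasDerivAt_id h).sub_const h).pow 2).const_mul
        (κ * Fintype.card G : ℝ)).neg).div_const 2
    simpa using h1.exp
  have hmain := hgau.mul (HasDerivAt.comp h hmgf hlin)
  have hfun : (fun h => (gibbs (energy c κ)).real (levSet A h)) =
      fun s => exp (-(κ * Fintype.card G * (s - h) ^ 2) / 2) *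
        ProbabilityTheory.mgf (fun φ => ∑ x, φ x)
          ((gibbs (energy c κ)).restrict (levSet A h)) (-κ * (s - h)) := by
    ext s
    rw [← key, add_sub_cancel]
  rw [hfun]
  convert! hmain using 1
  simp only [sub_self, mul_zero, zero_mul, exp_zero, mul_one, zero_add, one_mul, ne_eq,
    OfNat.ofNat_ne_zero, not_false_eq_true, zero_pow, neg_zero, zero_div]
  rw [integral_finsetSum _ fun x _ => (integrable_coord hE hκ hlow x).restrict]
  ring

end Energy

end LevelSetThreshold

open LevelSetThreshold

/-- **Differential inequality for translation-invariant events**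
(Corollary 4.4, eq. (4.11), periodic setting): for the translation-invariant
ferromagnetic Gaussian Gibbs measure on a finite additive group `G` and every
translation-invariant increasing event `A`,
`−(d/dh) μ(A^h) ≥ c · μ(A^h)(1 − μ(A^h)) · log|G|`, with `c = c(θ, M, v₀, v₁) > 0`. -/
theorem differential_inequality_translation_invariant
    (θ M v₀ v₁ : ℝ) (hθ : θ ∈ Set.Ioo (0 : ℝ) 1) (hM : 0 < M)
    (hv₀ : 0 < v₀) (hv : v₀ ≤ v₁) :
    ∃ c₂ : ℝ, 0 < c₂ ∧
      ∀ (G : Type) [AddGroup G] [Fintype G], 2 ≤ Fintype.card G →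
        ∀ chat : G → ℝ, (∀ g, 0 ≤ chat g) → (∀ g, chat (-g) = chat g) →
        ∀ κ₀ : ℝ, θ ≤ κ₀ →
        ∀ E : (G → ℝ) → ℝ,
          (∀ φ : G → ℝ,
            E φ = (1 / 2) * ∑ x, ∑ y, chat (y - x) * (φ y - φ x) ^ 2
              + κ₀ * ∑ x, (φ x) ^ 2) →
        ∀ Z : ℝ, Z = (∫ φ : G → ℝ, Real.exp (-(E φ) / 2)) →
        ∀ μ : Measure (G → ℝ),
          μ = volume.withDensity (fun φ => ENNReal.ofReal (Real.exp (-(E φ) / 2) / Z)) →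
        (∀ x : G, v₀ ≤ (∫ φ : G → ℝ, (φ x) ^ 2 ∂μ) ∧ (∫ φ : G → ℝ, (φ x) ^ 2 ∂μ) ≤ v₁) →
        ∀ A : Set (G → Bool),
          (∀ ω ω' : G → Bool, ω ∈ A → (∀ y, ω y ≤ ω' y) → ω' ∈ A) →
          (∀ (g : G) (ω : G → Bool), ω ∈ A ↔ (fun y => ω (y + g)) ∈ A) →
        ∀ h : ℝ, h ∈ Set.Ioo (-M) M →
          c₂ * ((μ (levSet A h)).toReal * (1 - (μ (levSet A h)).toReal)
              * Real.log (Fintype.card G))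
            ≤ -(deriv (fun h' : ℝ => (μ (levSet A h')).toReal) h) := by
  have hm0 : 0 < √v₀ / √(2 * π) * exp (-M ^ 2 / (2 * v₀)) := by positivity
  refine ⟨θ / 8 * (√v₀ / √(2 * π) * exp (-M ^ 2 / (2 * v₀))), by have := hθ.1; positivity, ?_⟩
  set m := √v₀ / √(2 * π) * exp (-M ^ 2 / (2 * v₀))
  intro G _ _ hG chat hchat _ κ₀ hκθ E hEφ Z hZ μ hμ hvar A hA hAinv h hh
  have hκ : 0 < κ₀ := hθ.1.trans_le hκθ
  have hc (x y : G) : 0 ≤ chat (y - x) := hchat _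
  obtain rfl : E = energy (fun x y => chat (y - x)) κ₀ := funext hEφ
  set E := energy (fun x y => chat (y - x)) κ₀
  have hE : Continuous E := continuous_energy _ _
  have hlow := mul_sum_sq_le_energy (κ := κ₀) hc
  obtain rfl : μ = gibbs E := by rw [hμ, hZ]; rfl
  have := isProbabilityMeasure_gibbs hE hκ hlow
  have hform := energy_eq_energyForm (fun x y : G => chat (y - x)) κ₀
  have hsymm := energyForm_comm (fun x y : G => chat (y - x)) κ₀
  set C := ∫ φ in levSet A h, φ 0 ∂gibbs E
  have hinv (x : G) : ∫ φ in levSet A h, φ x ∂gibbs E = C := by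
    have := setIntegral_gibbs_comp_equiv hE (Equiv.addRight x)
      (energy_comp_equiv _ _ _ fun y z => by simp)
      (measurableSet_levSet A h) (fun φ => (hAinv x fun y => decide (h ≤ φ y)).symm) 0
    simpa using this
  have hvarlog := levSet_variance_mul_log_le hE hκ hlow
    (energy_inf_add_energy_sup_le hc)
    (integral_coord_gibbs_eq_zero hE hform hsymm hκ hlow)
    (A := A) (fun ω ω' hω hωA => hA ω ω' hωA hω) hm0
    (fun x => le_setIntegral_coord_ge hE hform hsymm hκ hlow x hv₀ (hvar x).1
      (abs_le.2 ⟨hh.1.le, hh.2.le⟩)) (fun x => (hinv x).le)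
  have hderiv := (hasDerivAt_gibbs_levSet (A := A) hκ hc h).deriv
  simp only [measureReal_def] at hderiv hvarlog
  rw [hderiv, neg_neg, Finset.sum_congr rfl fun x _ => hinv x, Finset.sum_const, Finset.card_univ,
    nsmul_eq_mul]
  set p := (gibbs E (levSet A h)).toReal
  have hp : p ≤ 1 := measureReal_le_one
  have hV : 0 ≤ m * (p * (1 - p) * log (Fintype.card G)) :=
    mul_nonneg hm0.le (mul_nonneg (mul_nonneg ENNReal.toReal_nonneg (sub_nonneg.2 hp))
      (log_natCast_nonneg _))
  calc θ / 8 * m * (p * (1 - p) * log (Fintype.card G))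
      = θ / 8 * (m * (p * (1 - p) * log (Fintype.card G))) := by ring
    _ ≤ κ₀ / 8 * (m * (p * (1 - p) * log (Fintype.card G))) := by gcongr
    _ ≤ κ₀ / 8 * (8 * (Fintype.card G * C)) := by gcongr
    _ = κ₀ * (Fintype.card G * C) := by ring
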